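/- arXiv:math/0310394 — 8 statements merged into one kernel-verified Lean document; each statement's English description precedes it below -/
import Mathlib

section
/- Let m, p be coprime positive integers and let z ∈ ℂ be such that 2z+1 is a non-zero integer. Then F_{m,p,z} extends to an entire function on ℂ of exponential order: there exist constants A, C > 0 such that |F_{m,p,z}(x)| ≤ A·e^{C|x|} for all x ∈ ℂ. Consequently there is a constant C' > 0 such that the Taylor coefficients satisfy |Q_{m,p,z}(k)| ≤ C'^k / k! for all k ≥ 1. -/
open Complex Filter MeasureTheory Metric Set Topology
open scoped Real Nat Classical

/-- The meromorphic function `F_{m,p,z}` of the paper, with the convention that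
`sinh((2z+1)√(mp)x)/(2z+1)` is interpreted as its limit `√(mp)x` when `2z+1 = 0`. -/
noncomputable def Fmpz (m p : ℕ) (z x : ℂ) : ℂ :=
  ((if 2 * z + 1 = 0 then ((Real.sqrt ((m : ℝ) * (p : ℝ)) : ℂ) * x)
      else Complex.sinh ((2 * z + 1) * (Real.sqrt ((m : ℝ) * (p : ℝ)) : ℂ) * x) / (2 * z + 1))
    * Complex.sinh ((Real.sqrt ((m : ℝ) / (p : ℝ)) : ℂ) * x)
    * Complex.sinh ((Real.sqrt ((p : ℝ) / (m : ℝ)) : ℂ) * x))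
    / Complex.sinh ((Real.sqrt ((m : ℝ) * (p : ℝ)) : ℂ) * x)

/-- An entire function `g` with `‖g x‖ ≤ A * exp (C * ‖x‖)` for some positive `A` and `C`. -/
def IsEntireExpType (g : ℂ → ℂ) : Prop :=
  Differentiable ℂ g ∧
    ∃ A C : ℝ, 0 < A ∧ 0 < C ∧ ∀ x : ℂ, ‖g x‖ ≤ A * Real.exp (C * ‖x‖)

namespace IsEntireExpType

variable {f g : ℂ → ℂ}

theorem const (c : ℂ) : IsEntireExpType fun _ => c := by
  refine ⟨differentiable_const c, ‖c‖ + 1, 1, by positivity, one_pos, fun x => ?_⟩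
  have h : 1 ≤ Real.exp (1 * ‖x‖) := Real.one_le_exp (by positivity)
  nlinarith [norm_nonneg c]

theorem mul (hf : IsEntireExpType f) (hg : IsEntireExpType g) :
    IsEntireExpType fun x => f x * g x := by
  obtain ⟨hf, A, C, hA, hC, hfb⟩ := hf
  obtain ⟨hg, B, D, hB, hD, hgb⟩ := hg
  refine ⟨hf.mul hg, A * B, C + D, by positivity, by positivity, fun x => ?_⟩
  calc ‖f x * g x‖ = ‖f x‖ * ‖g x‖ := norm_mul _ _
    _ ≤ (A * Real.exp (C * ‖x‖)) * (B * Real.exp (D * ‖x‖)) := by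
      gcongr
      exacts [hfb x, hgb x]
    _ = A * B * Real.exp ((C + D) * ‖x‖) := by
      rw [add_mul, Real.exp_add]
      ring

theorem add (hf : IsEntireExpType f) (hg : IsEntireExpType g) :
    IsEntireExpType fun x => f x + g x := by
  obtain ⟨hf, A, C, hA, hC, hfb⟩ := hf
  obtain ⟨hg, B, D, hB, hD, hgb⟩ := hg
  refine ⟨hf.add hg, A + B, C + D, by positivity, by positivity, fun x => ?_⟩
  calc ‖f x + g x‖ ≤ ‖f x‖ + ‖g x‖ := norm_add_le _ _
    _ ≤ A * Real.exp (C * ‖x‖) + B * Real.exp (D * ‖x‖) := add_le_add (hfb x) (hgb x)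
    _ ≤ A * Real.exp ((C + D) * ‖x‖) + B * Real.exp ((C + D) * ‖x‖) := by
      gcongr <;> linarith
    _ = (A + B) * Real.exp ((C + D) * ‖x‖) := by ring

theorem comp_const_mul (hf : IsEntireExpType f) (a : ℂ) :
    IsEntireExpType fun x => f (a * x) := by
  obtain ⟨hf, A, C, hA, hC, hfb⟩ := hf
  refine ⟨hf.comp (differentiable_id.const_mul a), A, C * (‖a‖ + 1), hA, by positivity,
    fun x => (hfb _).trans ?_⟩
  rw [norm_mul, mul_assoc C]
  gcongr
  linarith

protected theorem exp : IsEntireExpType Complex.exp :=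
  ⟨Complex.differentiable_exp, 1, 1, one_pos, one_pos, fun x => by
    simpa using Complex.norm_exp_le_exp_norm x⟩

protected theorem cosh : IsEntireExpType Complex.cosh := by
  convert (IsEntireExpType.exp.add (IsEntireExpType.exp.comp_const_mul (-1))).mul (const 2⁻¹)
    using 2 with x
  rw [Complex.cosh, neg_one_mul, div_eq_mul_inv]

protected theorem sinh : IsEntireExpType Complex.sinh := by
  convert (IsEntireExpType.exp.add
    ((IsEntireExpType.exp.comp_const_mul (-1)).mul (const (-1)))).mul (const 2⁻¹) using 2 with x
  rw [Complex.sinh, neg_one_mul, div_eq_mul_inv]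
  ring

theorem exists_sinh_natCast_mul (n : ℕ) :
    ∃ U : ℂ → ℂ, IsEntireExpType U ∧ ∀ w, Complex.sinh (n * w) = Complex.sinh w * U w := by
  induction n with
  | zero => exact ⟨fun _ => 0, const 0, by simp⟩
  | succ n ih =>
    obtain ⟨U, hU, h⟩ := ih
    refine ⟨fun w => U w * Complex.cosh w + Complex.cosh (n * w),
      (hU.mul .cosh).add (IsEntireExpType.cosh.comp_const_mul n), fun w => ?_⟩
    rw [Nat.cast_succ, add_mul, one_mul, Complex.sinh_add, h]
    ring

theorem exists_sinh_intCast_mul (n : ℤ) :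
    ∃ U : ℂ → ℂ, IsEntireExpType U ∧ ∀ w, Complex.sinh (n * w) = Complex.sinh w * U w := by
  obtain ⟨k, rfl | rfl⟩ := n.eq_nat_or_neg
  · simpa using exists_sinh_natCast_mul k
  · obtain ⟨U, hU, h⟩ := exists_sinh_natCast_mul k
    refine ⟨fun w => U w * (-1), hU.mul (const (-1)), fun w => ?_⟩
    have := h w
    push_cast
    rw [neg_mul, Complex.sinh_neg, this]
    ring

/-- Cauchy's estimates for an entire function of exponential type whose Taylor expansion at `0`
has only even powers. -/
theorem exists_norm_coeff_le (hg : IsEntireExpType g) {Q : ℕ → ℂ}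
    (hQ : ∀ᶠ y in 𝓝 (0 : ℂ), HasSum (fun k : ℕ => Q k * y ^ (2 * k)) (g y)) :
    ∃ C' : ℝ, 0 < C' ∧ ∀ k : ℕ, 1 ≤ k → ‖Q k‖ ≤ C' ^ k / (k.factorial : ℝ) := by
  obtain ⟨hd, A, C, hA, hC, hb⟩ := hg
  let c : ℕ → ℂ := fun n => if Even n then Q (n / 2) else 0
  have hc (k : ℕ) : c (2 * k) = Q k := by simp [c]
  have hs : HasFPowerSeriesAt g (FormalMultilinearSeries.ofScalars ℂ c) 0 := by
    rw [hasFPowerSeriesAt_iff]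
    filter_upwards [hQ] with y hy
    have hinj : Function.Injective fun k : ℕ => 2 * k := fun a b h => by simpa using h
    rw [zero_add, ← hinj.hasSum_iff]
    · refine (congrArg (HasSum · (g y)) (funext fun k => ?_)).mpr hy
      simp [FormalMultilinearSeries.coeff_ofScalars, hc, mul_comm (Q k)]
    · intro n hn
      have : ¬ Even n := fun ⟨r, hr⟩ => hn ⟨r, by simp only; omega⟩
      simp [FormalMultilinearSeries.coeff_ofScalars, c, this]
  have hq (n : ℕ) : c n = iteratedDeriv n g 0 / n.factorial := by
    have h := congrArg (fun p => FormalMultilinearSeries.coeff p n)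
      (hs.eq_formalMultilinearSeries (hd.analyticAt 0).hasFPowerSeriesAt)
    simpa [FormalMultilinearSeries.coeff_ofScalars] using h
  refine ⟨max A 1 * Real.exp C, by positivity, fun k hk => ?_⟩
  have hk0 : (0 : ℝ) < k := by exact_mod_cast hk
  have hder := Complex.norm_iteratedDeriv_le_of_forall_mem_sphere_norm_le (2 * k) hk0
    hd.diffContOnCl (c := 0) (C := A * Real.exp (C * k)) fun w hw => by
      simpa [mem_sphere_zero_iff_norm.1 hw] using hb w
  have hfac : (k.factorial : ℝ) ≤ (k : ℝ) ^ (2 * k) := by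
    exact_mod_cast k.factorial_le_pow.trans (Nat.pow_le_pow_right hk (by omega))
  have hAk : A ≤ max A 1 ^ k :=
    (le_max_left A 1).trans (le_self_pow₀ (le_max_right A 1) (by omega))
  calc ‖Q k‖ = ‖iteratedDeriv (2 * k) g 0‖ / (2 * k).factorial := by
        rw [← hc, hq, norm_div, Complex.norm_natCast]
    _ ≤ (2 * k).factorial * (A * Real.exp (C * k)) / (k : ℝ) ^ (2 * k) / (2 * k).factorial := by
        gcongr
    _ = A * Real.exp (C * k) / (k : ℝ) ^ (2 * k) := by
        have : ((2 * k).factorial : ℝ) ≠ 0 := by positivity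
        field_simp
    _ ≤ max A 1 ^ k * Real.exp (C * k) / k.factorial := by gcongr
    _ = (max A 1 * Real.exp C) ^ k / k.factorial := by
        rw [mul_pow, ← Real.exp_nat_mul, mul_comm C]

end IsEntireExpType

/-- If `2z+1` is a non-zero integer, `F_{m,p,z}` extends to an entire function of
exponential order, and consequently its Taylor coefficients `Q_{m,p,z}(k)` at `0`
satisfy `|Q(k)| ≤ C'^k / k!`. -/
theorem stmt0 (m p : ℕ) (hm : 0 < m) (hp : 0 < p) (hcop : Nat.Coprime m p)
    (z : ℂ) (hz : ∃ n : ℤ, n ≠ 0 ∧ 2 * z + 1 = (n : ℂ))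
    (Q : ℕ → ℂ) (hQ0 : Q 0 = 0)
    (hQ : ∀ᶠ y in 𝓝 (0 : ℂ), HasSum (fun k : ℕ => Q k * y ^ (2 * k)) (Fmpz m p z y)) :
    (∃ g : ℂ → ℂ, Differentiable ℂ g ∧
      (∀ x : ℂ, Complex.sinh ((Real.sqrt ((m : ℝ) * (p : ℝ)) : ℂ) * x) ≠ 0 →
        g x = Fmpz m p z x) ∧
      ∃ A C : ℝ, 0 < A ∧ 0 < C ∧ ∀ x : ℂ, ‖g x‖ ≤ A * Real.exp (C * ‖x‖)) ∧
    ∃ C' : ℝ, 0 < C' ∧ ∀ k : ℕ, 1 ≤ k → ‖Q k‖ ≤ C' ^ k / (k.factorial : ℝ) := by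
  obtain ⟨n, hn, hzn⟩ := hz
  have hn' : (n : ℂ) ≠ 0 := by exact_mod_cast hn
  obtain ⟨U, hU, hsinh⟩ := IsEntireExpType.exists_sinh_intCast_mul n
  set s : ℂ := (Real.sqrt ((m : ℝ) * (p : ℝ)) : ℂ) with hs_def
  set a : ℂ := (Real.sqrt ((m : ℝ) / (p : ℝ)) : ℂ) with ha_def
  set b : ℂ := (Real.sqrt ((p : ℝ) / (m : ℝ)) : ℂ) with hb_def
  have hs : s ≠ 0 := by
    rw [hs_def, Complex.ofReal_ne_zero]
    positivity
  let g : ℂ → ℂ := fun x => U (s * x) * (n : ℂ)⁻¹ * Complex.sinh (a * x) * Complex.sinh (b * x)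
  have hg : IsEntireExpType g :=
    (((hU.comp_const_mul s).mul (.const _)).mul (IsEntireExpType.sinh.comp_const_mul a)).mul
      (IsEntireExpType.sinh.comp_const_mul b)
  have hgF : ∀ x : ℂ, Complex.sinh (s * x) ≠ 0 → g x = Fmpz m p z x := by
    intro x hx
    simp only [Fmpz, ← hs_def, ← ha_def, ← hb_def, hzn, if_neg hn', mul_assoc (n : ℂ), hsinh, g]
    field_simp
  refine ⟨⟨g, hg.1, hgF, hg.2⟩, hg.exists_norm_coeff_le ?_⟩
  have hne : ∀ᶠ y in 𝓝[≠] (0 : ℂ), Complex.sinh (s * y) ≠ 0 := by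
    have hder : HasDerivAt (fun y : ℂ => Complex.sinh (s * y)) s 0 := by
      simpa using ((hasDerivAt_id (0 : ℂ)).const_mul s).csinh
    exact hder.eventually_ne hs
  filter_upwards [hQ, eventually_nhdsWithin_iff.1 hne] with y hy hy'
  obtain rfl | hy0 := eq_or_ne y 0
  · simpa [Fmpz, g] using hy
  · rwa [hgF y (hy' hy0)]
end

section
/- Let m, p be coprime positive integers. For each integer k ≥ 1 there exists a polynomial p_k ∈ ℂ[X] (depending on m, p and k) such that Q_{m,p,z}(k) = p_k(z) for every z ∈ ℂ; that is, for fixed k the Taylor coefficient Q_{m,p,z}(k) of F_{m,p,z} at 0 depends polynomially on z. -/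
open Complex Filter MeasureTheory Metric Set Topology
open scoped Real Nat Classical

/-- The power series `P` converges to `f` near `0`. -/
def Represents (P : PowerSeries ℂ) (f : ℂ → ℂ) : Prop :=
  ∀ᶠ y in 𝓝 (0 : ℂ), HasSum (fun n : ℕ => PowerSeries.coeff n P * y ^ n) (f y)

theorem Represents.mul {P R : PowerSeries ℂ} {f g : ℂ → ℂ} (hf : Represents P f)
    (hg : Represents R g) : Represents (P * R) (fun y => f y * g y) := by
  filter_upwards [hf, hg] with y hfy hgy
  have hf' := summable_norm_iff.2 hfy.summable
  have hg' := summable_norm_iff.2 hgy.summable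
  have h := (summable_norm_sum_mul_antidiagonal_of_summable_norm hf' hg').of_norm.hasSum
  rw [← tsum_mul_tsum_eq_tsum_sum_antidiagonal_of_summable_norm hf' hg',
    hfy.tsum_eq, hgy.tsum_eq] at h
  refine (congrArg (HasSum · _) (funext fun n => ?_)).mpr h
  rw [PowerSeries.coeff_mul, Finset.sum_mul]
  refine Finset.sum_congr rfl fun kl hkl => ?_
  rw [← Finset.HasAntidiagonal.mem_antidiagonal.1 hkl, pow_add]
  ring

theorem Represents.congr {P : PowerSeries ℂ} {f g : ℂ → ℂ} (hf : Represents P f)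
    (h : ∀ᶠ y in 𝓝 (0 : ℂ), f y = g y) : Represents P g := by
  filter_upwards [hf, h] with y hy hfg
  rwa [← hfg]

theorem Represents.unique {P R : PowerSeries ℂ} {f : ℂ → ℂ} (hP : Represents P f)
    (hR : Represents R f) : P = R := by
  have key : ∀ {S : PowerSeries ℂ}, Represents S f → HasFPowerSeriesAt f
      (FormalMultilinearSeries.ofScalars ℂ fun n => PowerSeries.coeff n S) 0 := by
    intro S hS
    rw [hasFPowerSeriesAt_iff]
    filter_upwards [hS] with y hy
    simpa [FormalMultilinearSeries.coeff_ofScalars, mul_comm] using hy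
  have h := (key hP).eq_formalMultilinearSeries (key hR)
  ext n
  simpa [FormalMultilinearSeries.coeff_ofScalars] using
    congrArg (fun L => FormalMultilinearSeries.coeff L n) h

theorem represents_monomial (n : ℕ) (c : ℂ) :
    Represents (PowerSeries.monomial n c) (fun y => c * y ^ n) := by
  refine Eventually.of_forall fun y => ?_
  convert hasSum_single n ?_ using 1
  · simp
  · intro k hk
    simp [PowerSeries.coeff_monomial, hk]

theorem hasSum_even_iff {f : ℕ → ℂ} (hf : ∀ n, ¬ Even n → f n = 0) {a : ℂ} :
    HasSum (fun k => f (2 * k)) a ↔ HasSum f a := by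
  refine Function.Injective.hasSum_iff (g := fun k : ℕ => 2 * k)
    (mul_right_injective₀ two_ne_zero) fun n hn => hf n ?_
  rintro ⟨k, rfl⟩
  exact hn ⟨k, two_mul k⟩

/-- The entire function `sinh u / u`. -/
noncomputable def sinhc (u : ℂ) : ℂ := if u = 0 then 1 else Complex.sinh u / u

theorem mul_sinhc (u : ℂ) : u * sinhc u = Complex.sinh u := by
  unfold sinhc
  split_ifs with h
  · simp [h]
  · field_simp

theorem hasSum_sinhc (u : ℂ) :
    HasSum (fun k : ℕ => u ^ (2 * k) / ((2 * k + 1)! : ℂ)) (sinhc u) := by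
  by_cases h : u = 0
  · subst h
    convert hasSum_single (0 : ℕ) ?_ using 1
    · simp [sinhc]
    · intro k hk
      simp [hk]
  · have := (Complex.hasSum_sinh u).div_const u
    simp only [sinhc, if_neg h]
    refine (congrArg (HasSum · _) (funext fun k => ?_)).mpr this
    rw [pow_succ]
    field_simp

/-- The Taylor series of `sinhc (c * y)` at `y = 0`. -/
noncomputable def sinhcSeries (c : ℂ) : PowerSeries ℂ :=
  PowerSeries.mk fun n => if Even n then c ^ n / ((n + 1)! : ℂ) else 0

theorem represents_sinhcSeries (c : ℂ) :
    Represents (sinhcSeries c) (fun y => sinhc (c * y)) := by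
  refine Eventually.of_forall fun y => ?_
  rw [← hasSum_even_iff fun n hn => by simp [sinhcSeries, hn]]
  convert hasSum_sinhc (c * y) using 2 with k
  simp [sinhcSeries, mul_pow]
  ring

theorem sinhcSeries_mul_inv (c : ℂ) : sinhcSeries c * (sinhcSeries c)⁻¹ = 1 :=
  PowerSeries.mul_inv_cancel _ (by simp [sinhcSeries])

theorem eventually_sinh_mul_ne_zero {s : ℂ} (hs : s ≠ 0) :
    ∀ᶠ y in 𝓝[≠] (0 : ℂ), Complex.sinh (s * y) ≠ 0 := by
  have h : HasDerivAt (fun y : ℂ => Complex.sinh (s * y)) s 0 := by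
    simpa using ((hasDerivAt_id (0 : ℂ)).const_mul s).csinh
  exact h.eventually_ne hs

theorem Fmpz_mul_sinhc {m p : ℕ} (hm : 0 < m) (hp : 0 < p) (z : ℂ) :
    ∀ᶠ y in 𝓝 (0 : ℂ), Fmpz m p z y * sinhc ((√((m : ℝ) * p) : ℂ) * y) =
      ((√((m : ℝ) / p) : ℂ) * (√((p : ℝ) / m) : ℂ)) * y ^ 2 *
        sinhc ((√((m : ℝ) / p) : ℂ) * y) * sinhc ((√((p : ℝ) / m) : ℂ) * y) *
        sinhc ((2 * z + 1) * (√((m : ℝ) * p) : ℂ) * y) := by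
  have hs : (√((m : ℝ) * p) : ℂ) ≠ 0 := by
    have : 0 < √((m : ℝ) * p) := by positivity
    exact_mod_cast this.ne'
  filter_upwards [eventually_nhdsWithin_iff.1 (eventually_sinh_mul_ne_zero hs)] with y hy
  by_cases h0 : y = 0
  · subst h0
    simp [Fmpz]
  specialize hy h0
  unfold Fmpz
  set s : ℂ := (√((m : ℝ) * p) : ℂ)
  set a : ℂ := (√((m : ℝ) / p) : ℂ)
  set b : ℂ := (√((p : ℝ) / m) : ℂ)
  have hw : (if 2 * z + 1 = 0 then s * y
      else Complex.sinh ((2 * z + 1) * s * y) / (2 * z + 1)) =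
      s * y * sinhc ((2 * z + 1) * s * y) := by
    split_ifs with h
    · simp [h, sinhc]
    · rw [← mul_sinhc]
      field_simp
  rw [hw]
  rw [← mul_sinhc] at hy
  rw [← mul_sinhc (a * y), ← mul_sinhc (b * y), ← mul_sinhc (s * y)]
  have hy' := right_ne_zero_of_mul hy
  field_simp

/-- For each `k ≥ 1` the Taylor coefficient `Q_{m,p,z}(k)` of `F_{m,p,z}` at `0`
depends polynomially on `z`. -/
theorem stmt1 (m p : ℕ) (hm : 0 < m) (hp : 0 < p) (hcop : Nat.Coprime m p)
    (Q : ℂ → ℕ → ℂ) (hQ0 : ∀ z : ℂ, Q z 0 = 0)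
    (hQ : ∀ z : ℂ, ∀ᶠ y in 𝓝 (0 : ℂ),
      HasSum (fun k : ℕ => Q z k * y ^ (2 * k)) (Fmpz m p z y)) :
    ∀ k : ℕ, 1 ≤ k → ∃ pk : Polynomial ℂ, ∀ z : ℂ, Q z k = pk.eval z := by
  intro k _
  set s : ℂ := (√((m : ℝ) * p) : ℂ)
  set a : ℂ := (√((m : ℝ) / p) : ℂ)
  set b : ℂ := (√((p : ℝ) / m) : ℂ)
  set R : PowerSeries ℂ :=
    PowerSeries.monomial 2 (a * b) * sinhcSeries a * sinhcSeries b * (sinhcSeries s)⁻¹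
  have hcoeff (z : ℂ) :
      Q z k = PowerSeries.coeff (2 * k) (sinhcSeries ((2 * z + 1) * s) * R) := by
    set q : PowerSeries ℂ := PowerSeries.mk fun n => if Even n then Q z (n / 2) else 0 with hq
    have hqF : Represents q (Fmpz m p z) := by
      filter_upwards [hQ z] with y hy
      rw [← hasSum_even_iff fun n hn => by simp [hq, hn]]
      simpa [hq] using hy
    have hqS : q * sinhcSeries s = PowerSeries.monomial 2 (a * b) * sinhcSeries a *
        sinhcSeries b * sinhcSeries ((2 * z + 1) * s) :=
      ((hqF.mul (represents_sinhcSeries s)).congr (Fmpz_mul_sinhc hm hp z)).unique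
        ((((represents_monomial 2 (a * b)).mul (represents_sinhcSeries a)).mul
          (represents_sinhcSeries b)).mul (represents_sinhcSeries ((2 * z + 1) * s)))
    have hqR : q = sinhcSeries ((2 * z + 1) * s) * R := by
      calc q = q * sinhcSeries s * (sinhcSeries s)⁻¹ := by
            rw [mul_assoc, sinhcSeries_mul_inv, mul_one]
        _ = _ := by rw [hqS]; ring
    rw [← hqR]
    simp [hq]
  refine ⟨∑ ij ∈ Finset.HasAntidiagonal.antidiagonal (2 * k),
    (if Even ij.1 then ((2 * Polynomial.X + 1) * Polynomial.C s) ^ ij.1 *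
      Polynomial.C ((ij.1 + 1)! : ℂ)⁻¹ else 0) *
      Polynomial.C (PowerSeries.coeff ij.2 R), fun z => ?_⟩
  rw [hcoeff, PowerSeries.coeff_mul, Polynomial.eval_finsetSum]
  refine Finset.sum_congr rfl fun ij _ => ?_
  by_cases h : Even ij.1 <;> simp [sinhcSeries, h, div_eq_mul_inv]
end

section
/- Let m, p be coprime integers with m ≥ 2 and p ≥ 2, and let z ∈ ℂ be such that 2z+1 is not a non-zero integer. Then F_{m,p,z} has a non-removable singularity (a pole) at the point iπ/√(mp), and the Taylor series of F_{m,p,z} at 0 has radius of convergence exactly π/√(mp). In particular lim sup_{k→∞} |Q_{m,p,z}(k)|^{1/k} = mp/π², so there is a constant C > 0 with |Q_{m,p,z}(k)| > C^k for infinitely many k. -/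
open Complex Filter MeasureTheory Metric Set Topology
open scoped Real Nat Classical

/-- The formal power series in `y` whose sum is `∑ Q k * y ^ (2 * k)`. -/
noncomputable def evenSeries (Q : ℕ → ℂ) : FormalMultilinearSeries ℂ ℂ ℂ :=
  FormalMultilinearSeries.ofScalars ℂ fun n => if Even n then Q (n / 2) else 0

lemma evenSeries_coeff_two_mul (Q : ℕ → ℂ) (k : ℕ) : (evenSeries Q).coeff (2 * k) = Q k := by
  simp [evenSeries, FormalMultilinearSeries.coeff_ofScalars]

lemma evenSeries_coeff_of_notMem_range (Q : ℕ → ℂ) {n : ℕ}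
    (hn : n ∉ Set.range fun k : ℕ => 2 * k) : (evenSeries Q).coeff n = 0 := by
  have : ¬ Even n := fun h => hn (by
    obtain ⟨k, rfl⟩ := h
    exact ⟨k, by ring⟩)
  simp [evenSeries, FormalMultilinearSeries.coeff_ofScalars, this]

lemma two_mul_left_injective : Function.Injective fun k : ℕ => 2 * k :=
  fun a b h => by simpa using h

lemma hasFPowerSeriesAt_evenSeries {f : ℂ → ℂ} {Q : ℕ → ℂ}
    (hQ : ∀ᶠ y in 𝓝 (0 : ℂ), HasSum (fun k : ℕ => Q k * y ^ (2 * k)) (f y)) :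
    HasFPowerSeriesAt f (evenSeries Q) 0 := by
  rw [hasFPowerSeriesAt_iff]
  filter_upwards [hQ] with y hy
  rw [zero_add, ← two_mul_left_injective.hasSum_iff]
  · simpa only [Function.comp_def, evenSeries_coeff_two_mul, smul_eq_mul, mul_comm (Q _)] using hy
  · intro n hn
    simp [evenSeries_coeff_of_notMem_range Q hn]

lemma summable_norm_evenSeries_iff (Q : ℕ → ℂ) (y : ℂ) :
    (Summable fun n => ‖evenSeries Q n‖ * ‖y‖ ^ n) ↔
      Summable fun k : ℕ => ‖Q k * y ^ (2 * k)‖ := by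
  rw [← two_mul_left_injective.summable_iff]
  · simp [Function.comp_def, FormalMultilinearSeries.norm_apply_eq_norm_coef,
      evenSeries_coeff_two_mul]
  · intro n hn
    simp [FormalMultilinearSeries.norm_apply_eq_norm_coef, evenSeries_coeff_of_notMem_range Q hn]

lemma hasFPowerSeriesOnBall_of_differentiableOn_ball {f : ℂ → ℂ}
    {P : FormalMultilinearSeries ℂ ℂ ℂ} {R : ℝ} (hP : HasFPowerSeriesAt f P 0)
    (hf : DifferentiableOn ℂ f (ball 0 R)) {r : NNReal} (hr : 0 < r) (hrR : r < R) :
    HasFPowerSeriesOnBall f P 0 r := by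
  have h := (hf.mono (closedBall_subset_ball hrR)).hasFPowerSeriesOnBall hr
  rwa [hP.eq_formalMultilinearSeries h.hasFPowerSeriesAt]

lemma summable_norm_of_norm_lt {f : ℂ → ℂ} {Q : ℕ → ℂ} {R : ℝ}
    (hQ : ∀ᶠ y in 𝓝 (0 : ℂ), HasSum (fun k : ℕ => Q k * y ^ (2 * k)) (f y))
    (hf : DifferentiableOn ℂ f (ball 0 R)) {y : ℂ} (hy : ‖y‖ < R) :
    Summable fun k : ℕ => ‖Q k * y ^ (2 * k)‖ := by
  obtain ⟨r, hyr, hrR⟩ := exists_between hy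
  lift r to NNReal using (norm_nonneg y).trans hyr.le
  have h := hasFPowerSeriesOnBall_of_differentiableOn_ball (hasFPowerSeriesAt_evenSeries hQ) hf
    (by exact_mod_cast (norm_nonneg y).trans_lt hyr) hrR
  rw [← summable_norm_evenSeries_iff]
  refine (evenSeries Q).summable_norm_mul_pow (r := ‖y‖₊) (lt_of_lt_of_le ?_ h.r_le)
  exact_mod_cast hyr

lemma not_summable_norm_of_lt_norm {f : ℂ → ℂ} {Q : ℕ → ℂ} {x₀ : ℂ} (hx₀ : x₀ ≠ 0)
    (hQ : ∀ᶠ y in 𝓝 (0 : ℂ), HasSum (fun k : ℕ => Q k * y ^ (2 * k)) (f y))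
    (hf : DifferentiableOn ℂ f (ball 0 ‖x₀‖))
    (hpole : Tendsto (fun x => ‖f x‖) (𝓝[≠] x₀) atTop) {y : ℂ} (hy : ‖x₀‖ < ‖y‖) :
    ¬ Summable fun k : ℕ => ‖Q k * y ^ (2 * k)‖ := by
  intro hs
  rw [← summable_norm_evenSeries_iff] at hs
  have hrad : (‖y‖₊ : ENNReal) ≤ (evenSeries Q).radius :=
    (evenSeries Q).le_radius_of_summable_norm hs
  have hlt : (‖x₀‖₊ : ENNReal) < (evenSeries Q).radius :=
    lt_of_lt_of_le (by exact_mod_cast hy) hrad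
  have hsum := (evenSeries Q).hasFPowerSeriesOnBall (pos_of_gt hlt)
  have hcont : ContinuousAt (evenSeries Q).sum x₀ :=
    (hsum.analyticAt_of_mem (by simpa [edist_zero_right, enorm] using hlt)).continuousAt
  have heq : ∀ x ∈ ball (0 : ℂ) ‖x₀‖, (evenSeries Q).sum x = f x := by
    intro x hx
    rw [mem_ball_zero_iff] at hx
    obtain ⟨r, hxr, hr⟩ := exists_between hx
    lift r to NNReal using (norm_nonneg x).trans hxr.le
    have h := hasFPowerSeriesOnBall_of_differentiableOn_ball (hasFPowerSeriesAt_evenSeries hQ) hf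
      (by exact_mod_cast (norm_nonneg x).trans_lt hxr) hr
    have hx' : ‖x‖₊ < r := hxr
    simpa using (h.sum (y := x) (by rw [Metric.mem_eball, edist_zero_right]; exact_mod_cast hx')).symm
  have hne : (𝓝[ball (0 : ℂ) ‖x₀‖] x₀).NeBot := by
    rw [← mem_closure_iff_nhdsWithin_neBot, closure_ball _ (norm_ne_zero_iff.2 hx₀)]
    simp
  have h1 : Tendsto (fun x => ‖f x‖) (𝓝[ball (0 : ℂ) ‖x₀‖] x₀) atTop := by
    refine hpole.mono_left (nhdsWithin_mono _ fun x hx => ?_)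
    rintro rfl
    simp at hx
  have h2 : Tendsto (fun x => ‖f x‖) (𝓝[ball (0 : ℂ) ‖x₀‖] x₀)
      (𝓝 ‖(evenSeries Q).sum x₀‖) := by
    refine (hcont.norm.tendsto.mono_left nhdsWithin_le_nhds).congr' ?_
    filter_upwards [self_mem_nhdsWithin] with x hx
    rw [heq x hx]
  exact not_tendsto_nhds_of_tendsto_atTop h1 _ h2

lemma norm_mul_ofReal_sqrt_inv_pow (q : ℂ) {c : ℝ} (hc : 0 < c) (k : ℕ) :
    ‖q * ((Real.sqrt c)⁻¹ : ℂ) ^ (2 * k)‖ = ‖q‖ / c ^ k := by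
  rw [pow_mul, norm_mul, norm_pow, norm_pow, norm_inv, Complex.norm_real, inv_pow,
    Real.norm_of_nonneg (Real.sqrt_nonneg c), Real.sq_sqrt hc.le, inv_pow, div_eq_mul_inv]

lemma norm_ofReal_sqrt_inv (c : ℝ) : ‖((Real.sqrt c)⁻¹ : ℂ)‖ = (Real.sqrt c)⁻¹ := by
  rw [norm_inv, Complex.norm_real, Real.norm_of_nonneg (Real.sqrt_nonneg c)]

lemma eventually_norm_le_pow {Q : ℕ → ℂ} {R c : ℝ} (hR : 0 < R)
    (h : ∀ y : ℂ, ‖y‖ < R → Summable fun k : ℕ => ‖Q k * y ^ (2 * k)‖) (hc : (R ^ 2)⁻¹ < c) :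
    ∀ᶠ k in atTop, ‖Q k‖ ≤ c ^ k := by
  have hc0 : 0 < c := lt_trans (by positivity) hc
  have hy : ‖((Real.sqrt c)⁻¹ : ℂ)‖ < R := by
    rw [norm_ofReal_sqrt_inv, inv_lt_comm₀ (Real.sqrt_pos.2 hc0) hR]
    exact Real.lt_sqrt_of_sq_lt (by rwa [inv_pow])
  filter_upwards [(h _ hy).tendsto_atTop_zero.eventually_lt_const one_pos] with k hk
  rw [norm_mul_ofReal_sqrt_inv_pow _ hc0, div_lt_one (by positivity)] at hk
  exact hk.le

lemma frequently_pow_lt_norm {Q : ℕ → ℂ} {R c : ℝ} (hR : 0 < R)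
    (h : ∀ y : ℂ, R < ‖y‖ → ¬ Summable fun k : ℕ => ‖Q k * y ^ (2 * k)‖)
    (hc0 : 0 < c) (hc : c < (R ^ 2)⁻¹) :
    ∃ᶠ k in atTop, c ^ k < ‖Q k‖ := by
  intro hev
  obtain ⟨d, hcd, hd⟩ := exists_between hc
  have hd0 : 0 < d := hc0.trans hcd
  refine h ((Real.sqrt d)⁻¹ : ℂ) ?_ ?_
  · rw [norm_ofReal_sqrt_inv, lt_inv_comm₀ hR (Real.sqrt_pos.2 hd0),
      Real.sqrt_lt' (by positivity), inv_pow]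
    exact hd
  · have hgeom : Summable fun k : ℕ => (c / d) ^ k :=
      summable_geometric_of_lt_one (by positivity) ((div_lt_one hd0).2 hcd)
    refine hgeom.of_norm_bounded_eventually_nat ?_
    filter_upwards [hev] with k hk
    rw [norm_norm, norm_mul_ofReal_sqrt_inv_pow _ hd0, div_pow]
    exact div_le_div_of_nonneg_right (not_lt.1 hk) (by positivity)

lemma limsup_norm_rpow_inv_eq {Q : ℕ → ℂ} {a : ℝ} (ha : 0 < a)
    (hle : ∀ c, a < c → ∀ᶠ k in atTop, ‖Q k‖ ≤ c ^ k)
    (hlt : ∀ c, 0 < c → c < a → ∃ᶠ k in atTop, c ^ k < ‖Q k‖) :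
    limsup (fun k : ℕ => ‖Q k‖ ^ ((k : ℝ)⁻¹)) atTop = a := by
  have hle' : ∀ c, a < c → ∀ᶠ k : ℕ in atTop, ‖Q k‖ ^ ((k : ℝ)⁻¹) ≤ c := by
    intro c hc
    filter_upwards [hle c hc, eventually_ne_atTop 0] with k hk hk0
    have := Real.rpow_le_rpow (norm_nonneg _) hk (inv_nonneg.2 k.cast_nonneg)
    rwa [Real.pow_rpow_inv_natCast (ha.trans hc).le hk0] at this
  have hbdd : IsBoundedUnder (· ≤ ·) atTop fun k : ℕ => ‖Q k‖ ^ ((k : ℝ)⁻¹) :=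
    ⟨a + 1, eventually_map.2 (hle' _ (lt_add_one a))⟩
  have hcobdd : IsCoboundedUnder (· ≤ ·) atTop fun k : ℕ => ‖Q k‖ ^ ((k : ℝ)⁻¹) :=
    IsBoundedUnder.isCoboundedUnder_le
      ⟨0, eventually_map.2 (Eventually.of_forall fun k => by positivity)⟩
  refine le_antisymm (le_of_forall_gt_imp_ge_of_dense fun c hc =>
    limsup_le_of_le hcobdd (hle' c hc)) (le_of_forall_lt_imp_le_of_dense fun c hc => ?_)
  obtain ⟨d, hd, hda⟩ := exists_between (max_lt hc ha)
  have hd0 : 0 < d := (le_max_right c 0).trans_lt hd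
  refine ((le_max_left c 0).trans hd.le).trans (le_limsup_of_frequently_le ?_ hbdd)
  refine ((hlt d hd0 hda).and_eventually (eventually_ne_atTop 0)).mono fun k hk => ?_
  have := Real.rpow_le_rpow (by positivity) hk.1.le (inv_nonneg.2 (Nat.cast_nonneg (α := ℝ) k))
  rwa [Real.pow_rpow_inv_natCast hd0.le hk.2] at this

lemma sinh_ne_zero_of_norm_lt_pi {w : ℂ} (hw0 : w ≠ 0) (hw : ‖w‖ < π) : Complex.sinh w ≠ 0 := by
  intro h
  have h' : Complex.sin (w * I) = 0 := by rw [Complex.sin_mul_I, h, zero_mul]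
  obtain ⟨n, hn⟩ := Complex.sin_eq_zero_iff.1 h'
  have hnorm : ‖w‖ = |(n : ℝ)| * π := by
    simpa [abs_of_pos Real.pi_pos] using congrArg norm hn
  rcases eq_or_ne n 0 with rfl | hn0
  · simp at hnorm
    exact hw0 hnorm
  · have : (1 : ℝ) ≤ |(n : ℝ)| := by exact_mod_cast Int.one_le_abs hn0
    nlinarith [Real.pi_pos]

lemma tendsto_norm_div_atTop {g h : ℂ → ℂ} {h' x₀ : ℂ} (hg : ContinuousAt g x₀) (hg0 : g x₀ ≠ 0)
    (hh : HasDerivAt h h' x₀) (hh' : h' ≠ 0) (hh0 : h x₀ = 0) :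
    Tendsto (fun x => ‖g x / h x‖) (𝓝[≠] x₀) atTop := by
  have hzero : Tendsto (fun x => ‖h x‖) (𝓝[≠] x₀) (𝓝[>] 0) := by
    refine tendsto_nhdsWithin_iff.2 ⟨?_, ?_⟩
    · simpa [hh0] using hh.continuousAt.norm.tendsto.mono_left nhdsWithin_le_nhds
    · filter_upwards [hh.eventually_ne hh' (c := 0)] with x hx
      exact norm_pos_iff.2 hx
  simp_rw [norm_div, div_eq_mul_inv]
  exact (hg.norm.tendsto.mono_left nhdsWithin_le_nhds).pos_mul_atTop (norm_pos_iff.2 hg0)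
    hzero.inv_tendsto_nhdsGT_zero

/-- The numerator of `Fmpz`. -/
noncomputable def FmpzNum (m p : ℕ) (z x : ℂ) : ℂ :=
  (if 2 * z + 1 = 0 then ((Real.sqrt ((m : ℝ) * (p : ℝ)) : ℂ) * x)
      else Complex.sinh ((2 * z + 1) * (Real.sqrt ((m : ℝ) * (p : ℝ)) : ℂ) * x) / (2 * z + 1))
    * Complex.sinh ((Real.sqrt ((m : ℝ) / (p : ℝ)) : ℂ) * x)
    * Complex.sinh ((Real.sqrt ((p : ℝ) / (m : ℝ)) : ℂ) * x)

lemma differentiable_FmpzNum (m p : ℕ) (z : ℂ) : Differentiable ℂ (FmpzNum m p z) := by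
  unfold FmpzNum
  split_ifs <;> fun_prop

lemma Fmpz_eq_div (m p : ℕ) (z : ℂ) : Fmpz m p z =
    fun x => FmpzNum m p z x / Complex.sinh ((Real.sqrt ((m : ℝ) * (p : ℝ)) : ℂ) * x) := rfl

lemma sqrt_div_div_sqrt_mul {a b : ℝ} (ha : 0 < a) (hb : 0 < b) :
    Real.sqrt (a / b) / Real.sqrt (a * b) = 1 / b := by
  rw [← Real.sqrt_div (by positivity), show a / b / (a * b) = (1 / b) ^ 2 by field_simp,
    Real.sqrt_sq (by positivity)]

lemma sinh_sqrt_div_mul_ne_zero {a b : ℝ} (ha : 0 < a) (hb : 1 < b) :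
    Complex.sinh ((Real.sqrt (a / b) : ℂ) * (I * (π : ℂ) / (Real.sqrt (a * b) : ℂ))) ≠ 0 := by
  have hb0 : 0 < b := one_pos.trans hb
  have h : (Real.sqrt (a / b) : ℂ) * (I * (π : ℂ) / (Real.sqrt (a * b) : ℂ)) =
      ((1 / b * π : ℝ) : ℂ) * I := by
    rw [← sqrt_div_div_sqrt_mul ha hb0]
    push_cast
    ring
  rw [h]
  have hpos : 0 < 1 / b * π := by positivity
  refine sinh_ne_zero_of_norm_lt_pi
    (mul_ne_zero (Complex.ofReal_ne_zero.2 hpos.ne') I_ne_zero) ?_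
  rw [norm_mul, norm_I, mul_one, Complex.norm_real, Real.norm_of_nonneg hpos.le]
  exact mul_lt_of_lt_one_left Real.pi_pos ((div_lt_one hb0).2 hb)

lemma FmpzNum_ne_zero {m p : ℕ} (hm : 2 ≤ m) (hp : 2 ≤ p) {z : ℂ}
    (hz : ¬ ∃ n : ℤ, n ≠ 0 ∧ 2 * z + 1 = (n : ℂ)) :
    FmpzNum m p z (I * (π : ℂ) / (Real.sqrt ((m : ℝ) * (p : ℝ)) : ℂ)) ≠ 0 := by
  have hm1 : (1 : ℝ) < m := by exact_mod_cast hm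
  have hp1 : (1 : ℝ) < p := by exact_mod_cast hp
  have hs : (Real.sqrt ((m : ℝ) * (p : ℝ)) : ℂ) ≠ 0 :=
    Complex.ofReal_ne_zero.2 (Real.sqrt_pos.2 (by positivity)).ne'
  have hpi : (π : ℂ) ≠ 0 := Complex.ofReal_ne_zero.2 Real.pi_ne_zero
  refine mul_ne_zero (mul_ne_zero ?_ (sinh_sqrt_div_mul_ne_zero (by positivity) hp1)) ?_
  · split_ifs with h
    · exact mul_ne_zero hs (div_ne_zero (mul_ne_zero I_ne_zero hpi) hs)
    · refine div_ne_zero ?_ h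
      rw [mul_assoc, mul_div_cancel₀ _ hs,
        show (2 * z + 1) * (I * (π : ℂ)) = ((2 * z + 1) * π) * I by ring, Complex.sinh_mul_I]
      refine mul_ne_zero (fun h0 => ?_) I_ne_zero
      obtain ⟨n, hn⟩ := Complex.sin_eq_zero_iff.1 h0
      have hn' := mul_right_cancel₀ hpi hn
      refine hz ⟨n, ?_, hn'⟩
      rintro rfl
      exact h (by simpa using hn')
  · rw [mul_comm (m : ℝ) (p : ℝ)]
    exact sinh_sqrt_div_mul_ne_zero (by positivity) hm1

lemma tendsto_norm_Fmpz_atTop {m p : ℕ} (hm : 2 ≤ m) (hp : 2 ≤ p) {z : ℂ}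
    (hz : ¬ ∃ n : ℤ, n ≠ 0 ∧ 2 * z + 1 = (n : ℂ)) :
    Tendsto (fun x : ℂ => ‖Fmpz m p z x‖)
      (𝓝[≠] (I * (π : ℂ) / (Real.sqrt ((m : ℝ) * (p : ℝ)) : ℂ))) atTop := by
  have hs : (Real.sqrt ((m : ℝ) * (p : ℝ)) : ℂ) ≠ 0 :=
    Complex.ofReal_ne_zero.2 (Real.sqrt_pos.2 (by positivity)).ne'
  rw [Fmpz_eq_div]
  refine tendsto_norm_div_atTop (differentiable_FmpzNum m p z _).continuousAt
    (FmpzNum_ne_zero hm hp hz) (((hasDerivAt_id _).const_mul _).csinh) ?_ ?_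
  · simp only [mul_div_cancel₀ _ hs]
    rw [mul_comm I, Complex.cosh_mul_I]
    simpa using hs
  · rw [mul_div_cancel₀ _ hs, mul_comm I, Complex.sinh_mul_I]
    simp

lemma differentiableOn_Fmpz {m p : ℕ} (hm : 0 < m) (hp : 0 < p) {z : ℂ}
    (h0 : DifferentiableAt ℂ (Fmpz m p z) 0) :
    DifferentiableOn ℂ (Fmpz m p z) (ball 0 (π / Real.sqrt ((m : ℝ) * (p : ℝ)))) := by
  have hs : 0 < Real.sqrt ((m : ℝ) * (p : ℝ)) := Real.sqrt_pos.2 (by positivity)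
  intro x hx
  refine DifferentiableAt.differentiableWithinAt ?_
  rcases eq_or_ne x 0 with rfl | hx0
  · exact h0
  rw [Fmpz_eq_div]
  refine (differentiable_FmpzNum m p z x).fun_div (by fun_prop)
    (sinh_ne_zero_of_norm_lt_pi (mul_ne_zero (Complex.ofReal_ne_zero.2 hs.ne') hx0) ?_)
  rw [mem_ball_zero_iff, lt_div_iff₀ hs] at hx
  rwa [norm_mul, Complex.norm_real, Real.norm_of_nonneg hs.le, mul_comm]

/-- If `2z+1` is not a non-zero integer then `F_{m,p,z}` has a pole (a non-removable
singularity) at `iπ/√(mp)`, its Taylor series at `0` has radius of convergence exactly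
`π/√(mp)`, `limsup |Q(k)|^{1/k} = mp/π²`, and `|Q(k)| > C^k` for infinitely many `k`. -/
theorem stmt2 (m p : ℕ) (hm : 2 ≤ m) (hp : 2 ≤ p) (hcop : Nat.Coprime m p)
    (z : ℂ) (hz : ¬ ∃ n : ℤ, n ≠ 0 ∧ 2 * z + 1 = (n : ℂ))
    (Q : ℕ → ℂ) (hQ0 : Q 0 = 0)
    (hQ : ∀ᶠ y in 𝓝 (0 : ℂ), HasSum (fun k : ℕ => Q k * y ^ (2 * k)) (Fmpz m p z y)) :
    Tendsto (fun x : ℂ => ‖Fmpz m p z x‖)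
      (𝓝[≠] (Complex.I * (Real.pi : ℂ) / ((Real.sqrt ((m : ℝ) * (p : ℝ)) : ℝ) : ℂ))) atTop ∧
    (∀ y : ℂ, ‖y‖ < Real.pi / Real.sqrt ((m : ℝ) * (p : ℝ)) →
      Summable fun k : ℕ => ‖Q k * y ^ (2 * k)‖) ∧
    (∀ y : ℂ, Real.pi / Real.sqrt ((m : ℝ) * (p : ℝ)) < ‖y‖ →
      ¬ Summable fun k : ℕ => ‖Q k * y ^ (2 * k)‖) ∧
    Filter.limsup (fun k : ℕ => ‖Q k‖ ^ ((k : ℝ)⁻¹)) atTop = (m : ℝ) * (p : ℝ) / Real.pi ^ 2 ∧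
    ∃ C : ℝ, 0 < C ∧ ∃ᶠ k : ℕ in atTop, C ^ k < ‖Q k‖ := by
  have hs : 0 < Real.sqrt ((m : ℝ) * (p : ℝ)) := Real.sqrt_pos.2 (by positivity)
  have hR : 0 < π / Real.sqrt ((m : ℝ) * (p : ℝ)) := div_pos Real.pi_pos hs
  have hnorm : ‖I * (π : ℂ) / ((Real.sqrt ((m : ℝ) * (p : ℝ)) : ℝ) : ℂ)‖ =
      π / Real.sqrt ((m : ℝ) * (p : ℝ)) := by
    rw [norm_div, norm_mul, norm_I, one_mul, Complex.norm_real, Complex.norm_real,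
      Real.norm_of_nonneg hs.le, Real.norm_of_nonneg Real.pi_pos.le]
  have ha : (m : ℝ) * (p : ℝ) / π ^ 2 = ((π / Real.sqrt ((m : ℝ) * (p : ℝ))) ^ 2)⁻¹ := by
    rw [div_pow, Real.sq_sqrt (by positivity), inv_div]
  have ha0 : 0 < (m : ℝ) * (p : ℝ) / π ^ 2 := by positivity
  have hpole := tendsto_norm_Fmpz_atTop hm hp hz
  have hdiff := differentiableOn_Fmpz (by omega) (by omega)
    (hasFPowerSeriesAt_evenSeries hQ).analyticAt.differentiableAt
  have hin : ∀ y : ℂ, ‖y‖ < π / Real.sqrt ((m : ℝ) * (p : ℝ)) →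
      Summable fun k : ℕ => ‖Q k * y ^ (2 * k)‖ :=
    fun y hy => summable_norm_of_norm_lt hQ hdiff hy
  have hout : ∀ y : ℂ, π / Real.sqrt ((m : ℝ) * (p : ℝ)) < ‖y‖ →
      ¬ Summable fun k : ℕ => ‖Q k * y ^ (2 * k)‖ := by
    rw [← hnorm] at hdiff hR ⊢
    exact fun y hy => not_summable_norm_of_lt_norm (norm_pos_iff.1 hR) hQ hdiff hpole hy
  have hfreq : ∀ c, 0 < c → c < (m : ℝ) * (p : ℝ) / π ^ 2 →
      ∃ᶠ k in atTop, c ^ k < ‖Q k‖ :=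
    fun c hc0 hc => frequently_pow_lt_norm hR hout hc0 (ha ▸ hc)
  exact ⟨hpole, hin, hout,
    limsup_norm_rpow_inv_eq ha0 (fun c hc => eventually_norm_le_pow hR hin (ha ▸ hc)) hfreq,
    _, half_pos ha0, hfreq _ (half_pos ha0) (half_lt_self ha0)⟩
end

section
/- Let m, p be coprime integers with m ≥ 2 and p ≥ 2, and let z ∈ ℂ be such that 2z+1 is not a non-zero integer. Then the power series Σ_{k≥1} Γ(k + 1/2) · Q_{m,p,z}(k) · h^k in the variable h has radius of convergence equal to 0. -/
open Complex Filter MeasureTheory Metric Set Topology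
open scoped Real Nat Classical

/-- Geometric growth is negligible against `Γ(k + 1/2)`. -/
lemma summable_pow_div_Gamma_add_half (C : ℝ) (hC : 0 < C) :
    Summable fun k : ℕ => C ^ k / Real.Gamma ((k : ℝ) + 1 / 2) := by
  have hG : ∀ k : ℕ, 0 < Real.Gamma ((k : ℝ) + 1 / 2) := fun k =>
    Real.Gamma_pos_of_pos (by positivity)
  have hlim : Tendsto (fun k : ℕ => C / ((k : ℝ) + 1 / 2)) atTop (𝓝 0) :=
    Tendsto.const_div_atTop (tendsto_atTop_add_const_right _ _ tendsto_natCast_atTop_atTop) C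
  refine summable_of_ratio_test_tendsto_lt_one (l := 0) one_pos
    (Eventually.of_forall fun k => (div_pos (pow_pos hC k) (hG k)).ne') (hlim.congr fun k => ?_)
  have hk : (0 : ℝ) < (k : ℝ) + 1 / 2 := by positivity
  have hrec : Real.Gamma (((k + 1 : ℕ) : ℝ) + 1 / 2)
      = ((k : ℝ) + 1 / 2) * Real.Gamma ((k : ℝ) + 1 / 2) := by
    rw [← Real.Gamma_add_one hk.ne']
    push_cast
    ring_nf
  rw [Real.norm_of_nonneg (div_pos (pow_pos hC _) (hG _)).le,
    Real.norm_of_nonneg (div_pos (pow_pos hC _) (hG _)).le, hrec]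
  have := (hG k).ne'
  have := hk.ne'
  field_simp
  ring

/-- If the Gamma-weighted series converges absolutely at some `h ≠ 0`, the even power series with
the unweighted coefficients converges absolutely everywhere. -/
lemma summable_norm_mul_pow_of_summable_Gamma {Q : ℕ → ℂ} {h : ℂ} (hh : h ≠ 0)
    (hs : Summable fun k : ℕ => ‖((Real.Gamma ((k : ℝ) + 1 / 2) : ℝ) : ℂ) * Q k * h ^ k‖)
    (R : ℝ) (hR : 0 < R) : Summable fun k : ℕ => ‖Q k‖ * R ^ (2 * k) := by
  have hn : 0 < ‖h‖ := norm_pos_iff.2 hh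
  have h0 := (summable_pow_div_Gamma_add_half (R ^ 2 / ‖h‖) (by positivity)).tendsto_atTop_zero
  refine Summable.of_norm_bounded_eventually_nat hs ?_
  filter_upwards [h0.eventually_le_const one_pos] with k hk
  have hG : 0 < Real.Gamma ((k : ℝ) + 1 / 2) := Real.Gamma_pos_of_pos (by positivity)
  rw [div_le_one hG, div_pow, div_le_iff₀ (by positivity), ← pow_mul] at hk
  rw [Real.norm_of_nonneg (by positivity), norm_mul, norm_mul, norm_pow, Complex.norm_real,
    Real.norm_of_nonneg hG.le]
  calc ‖Q k‖ * R ^ (2 * k) ≤ ‖Q k‖ * (Real.Gamma ((k : ℝ) + 1 / 2) * ‖h‖ ^ k) := by gcongr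
    _ = _ := by ring

/-- An everywhere absolutely convergent even power series is entire. -/
lemma differentiable_tsum_mul_pow {Q : ℕ → ℂ}
    (hs : ∀ R : ℝ, 0 < R → Summable fun k : ℕ => ‖Q k‖ * R ^ (2 * k)) :
    Differentiable ℂ fun y : ℂ => ∑' k : ℕ, Q k * y ^ (2 * k) := by
  intro y
  have hR : 0 < ‖y‖ + 1 := by positivity
  have hd : DifferentiableOn ℂ (fun y : ℂ => ∑' k : ℕ, Q k * y ^ (2 * k)) (ball 0 (‖y‖ + 1)) := by
    refine differentiableOn_tsum_of_summable_norm (hs _ hR) (fun k => by fun_prop) isOpen_ball ?_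
    intro k w hw
    rw [norm_mul, norm_pow]
    gcongr
    simpa using (mem_ball_zero_iff.1 hw).le
  exact hd.differentiableAt (isOpen_ball.mem_nhds (by simp))

/-- If a quotient `N / D` with `D` having a simple zero at `0` extends from a neighbourhood of `0`
to an entire function, then `N` vanishes at all zeros of `D`. -/
lemma eq_zero_of_div_eq_entire {G N D : ℂ → ℂ} (hG : Differentiable ℂ G)
    (hN : Differentiable ℂ N) (hD : Differentiable ℂ D) (hD0 : deriv D 0 ≠ 0)
    (hev : ∀ᶠ y in 𝓝 (0 : ℂ), G y = N y / D y) {w : ℂ} (hw : D w = 0) : N w = 0 := by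
  have hne : ∀ᶠ y in 𝓝[≠] (0 : ℂ), D y ≠ 0 := (hD 0).hasDerivAt.eventually_ne hD0
  have heq : N = fun y => G y * D y := by
    refine AnalyticOnNhd.eq_of_frequently_eq (z₀ := 0)
      (fun y _ => hN.analyticAt y) (fun y _ => (hG.mul hD).analyticAt y) (Eventually.frequently ?_)
    filter_upwards [hne, hev.filter_mono nhdsWithin_le_nhds] with y h1 h2
    rw [h2, div_mul_cancel₀ _ h1]
  rw [heq]
  simp [hw]

lemma sinh_pi_div_mul_I_ne_zero {n : ℕ} (hn : 2 ≤ n) : Complex.sinh ((π / n : ℝ) * I) ≠ 0 := by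
  have h2 : (2 : ℝ) ≤ n := by exact_mod_cast hn
  rw [Complex.sinh_mul_I, ← Complex.ofReal_sin]
  refine mul_ne_zero (Complex.ofReal_ne_zero.2 (Real.sin_pos_of_pos_of_lt_pi ?_ ?_).ne') I_ne_zero
  · have := Real.pi_pos
    positivity
  · exact div_lt_self Real.pi_pos (by linarith)

/-- If `2z+1` is not a non-zero integer then the power series
`Σ_{k≥1} Γ(k+1/2) Q_{m,p,z}(k) h^k` has radius of convergence `0`:
it is not absolutely summable at any `h ≠ 0`. -/
theorem stmt3 (m p : ℕ) (hm : 2 ≤ m) (hp : 2 ≤ p) (hcop : Nat.Coprime m p)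
    (z : ℂ) (hz : ¬ ∃ n : ℤ, n ≠ 0 ∧ 2 * z + 1 = (n : ℂ))
    (Q : ℕ → ℂ) (hQ0 : Q 0 = 0)
    (hQ : ∀ᶠ y in 𝓝 (0 : ℂ), HasSum (fun k : ℕ => Q k * y ^ (2 * k)) (Fmpz m p z y)) :
    ∀ h : ℂ, h ≠ 0 →
      ¬ Summable fun k : ℕ => ‖((Real.Gamma ((k : ℝ) + 1 / 2) : ℝ) : ℂ) * Q k * h ^ k‖ := by
  intro h hh hs
  have hsum := summable_norm_mul_pow_of_summable_Gamma hh hs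
  have hm0 : (0 : ℝ) < m := by exact_mod_cast (by omega : 0 < m)
  have hp0 : (0 : ℝ) < p := by exact_mod_cast (by omega : 0 < p)
  set a : ℝ := Real.sqrt ((m : ℝ) * (p : ℝ)) with ha
  have ha0 : 0 < a := Real.sqrt_pos.2 (by positivity)
  have haC : (a : ℂ) ≠ 0 := Complex.ofReal_ne_zero.2 ha0.ne'
  have hb : Real.sqrt ((m : ℝ) / p) = a / p := by
    rw [show (m : ℝ) / p = m * p / p ^ 2 by field_simp, Real.sqrt_div' _ (by positivity),
      Real.sqrt_sq hp0.le]
  have hc : Real.sqrt ((p : ℝ) / m) = a / m := by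
    rw [show (p : ℝ) / m = m * p / m ^ 2 by field_simp, Real.sqrt_div' _ (by positivity),
      Real.sqrt_sq hm0.le]
  let w : ℂ := (π : ℂ) * I / a
  have haw : (a : ℂ) * w = π * I := by simp only [w]; field_simp
  have hdiv : ∀ n : ℕ, ((a / n : ℝ) : ℂ) * w = (π / n : ℝ) * I := fun n => by
    push_cast
    linear_combination (1 / (n : ℂ)) * haw
  have hderiv : HasDerivAt (fun y : ℂ => Complex.sinh (a * y)) a 0 := by
    simpa using ((hasDerivAt_id (0 : ℂ)).const_mul (a : ℂ)).csinh
  have key := eq_zero_of_div_eq_entire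
    (N := fun y => (if 2 * z + 1 = 0 then ((a : ℂ) * y)
      else Complex.sinh ((2 * z + 1) * (a : ℂ) * y) / (2 * z + 1))
      * Complex.sinh ((Real.sqrt ((m : ℝ) / (p : ℝ)) : ℂ) * y)
      * Complex.sinh ((Real.sqrt ((p : ℝ) / (m : ℝ)) : ℂ) * y))
    (D := fun y => Complex.sinh (a * y)) (w := w)
    (differentiable_tsum_mul_pow hsum) (by split_ifs <;> fun_prop) (by fun_prop)
    (by rwa [hderiv.deriv]) (hQ.mono fun y hy => hy.tsum_eq)
    (by simp [haw, Complex.sinh_mul_I])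
  simp only [hb, hc, hdiv] at key
  have hfirst := (mul_eq_zero.1 ((mul_eq_zero.1 key).resolve_right
    (sinh_pi_div_mul_I_ne_zero hm))).resolve_right (sinh_pi_div_mul_I_ne_zero hp)
  split_ifs at hfirst with h0
  · rw [haw] at hfirst
    exact mul_ne_zero (Complex.ofReal_ne_zero.2 Real.pi_ne_zero) I_ne_zero hfirst
  · rw [mul_assoc, haw, ← mul_assoc, Complex.sinh_mul_I] at hfirst
    have hsin : Complex.sin ((2 * z + 1) * π) = 0 := by simpa [h0] using hfirst
    obtain ⟨n, hn⟩ := Complex.sin_eq_zero_iff.1 hsin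
    have hzn := mul_right_cancel₀ (Complex.ofReal_ne_zero.2 Real.pi_ne_zero) hn
    exact hz ⟨n, fun hn0 => h0 (by simp [hzn, hn0]), hzn⟩
end

section
/- Let m, p be coprime integers with m ≥ 2 and p ≥ 2, let z ∈ ℂ be arbitrary, and let w ∈ ℂ be such that 2w+1 is not a non-zero integer. Set w₀ = π/√(mp), the first singularity of x ↦ F_{m,p,w}(ix) on the positive real axis. Then G_{m,p,z,w} is defined and differentiable on the real interval [0, w₀), and |G'_{m,p,z,w}(x)| → +∞ as x → w₀ from below along the real line. In particular G_{m,p,z,w} does not extend analytically to any neighbourhood of w₀. -/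
open Complex Filter MeasureTheory Metric Set Topology
open scoped Real Nat Classical

theorem exists_eq_sub_mul_of_differentiable {f : ℂ → ℂ} (hf : Differentiable ℂ f) {c : ℂ}
    (hc : f c = 0) : ∃ g : ℂ → ℂ, Differentiable ℂ g ∧ ∀ u, f u = (u - c) * g u := by
  refine ⟨dslope f c, ?_, fun u => ?_⟩
  · rw [← differentiableOn_univ, Complex.differentiableOn_dslope univ_mem]
    exact hf.differentiableOn
  · have := sub_smul_dslope f c u
    simp only [smul_eq_mul, hc, sub_zero] at this
    exact this.symm

/-- An entire cofactor of the three zeros of `sinh (s u)` closest to the origin. -/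
theorem exists_sinh_mul_eq {s : ℝ} (hs : 0 < s) :
    ∃ k : ℂ → ℂ, Differentiable ℂ k ∧
      (∀ u : ℂ, sinh (s * u) = u * (u ^ 2 + ((π / s : ℝ) : ℂ) ^ 2) * k u) ∧
      (∀ u : ℂ, |u.im| < 2 * (π / s) → k u ≠ 0) ∧
      k (-(I * (π / s : ℝ))) = k (I * (π / s : ℝ)) := by
  set ω : ℝ := π / s with hω
  have hω0 : 0 < ω := by positivity
  have hωC : (ω : ℂ) ≠ 0 := by exact_mod_cast hω0.ne'
  have hsω : (s : ℂ) * ω = π := by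
    rw [hω]; push_cast; field_simp [show (s : ℂ) ≠ 0 by exact_mod_cast hs.ne']
  have hd : Differentiable ℂ fun u : ℂ => sinh (s * u) := by fun_prop
  have hsin : sinh (s * (I * ω)) = 0 := by
    rw [show (s : ℂ) * (I * ω) = π * I by rw [← hsω]; ring, Complex.sinh_mul_I, Complex.sin_pi,
      zero_mul]
  obtain ⟨g, hg, hgu⟩ := exists_eq_sub_mul_of_differentiable hd (c := 0) (by simp)
  have hg0 : g (I * ω) = 0 := by
    have := hgu (I * ω)
    rw [hsin, sub_zero] at this
    simpa [hωC] using this.symm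
  obtain ⟨h, hh, hhu⟩ := exists_eq_sub_mul_of_differentiable hg hg0
  have hh0 : h (-(I * ω)) = 0 := by
    have := hgu (-(I * ω))
    rw [hhu, mul_neg, Complex.sinh_neg, hsin, sub_zero] at this
    have h2 : -(I * (ω : ℂ)) - I * ω ≠ 0 := by
      rw [show -(I * (ω : ℂ)) - I * ω = -2 * I * ω by ring]; simp [hωC]
    simpa [hωC, h2] using this.symm
  obtain ⟨k, hk, hku⟩ := exists_eq_sub_mul_of_differentiable hh hh0
  have hfac : ∀ u : ℂ, sinh (s * u) = u * (u ^ 2 + (ω : ℂ) ^ 2) * k u := fun u => by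
    rw [hgu, hhu, hku]
    linear_combination (-(u * k u * (ω : ℂ) ^ 2)) * I_sq
  have hder : ∀ u : ℂ, s * cosh (s * u) =
      (3 * u ^ 2 + (ω : ℂ) ^ 2) * k u + u * (u ^ 2 + (ω : ℂ) ^ 2) * deriv k u := fun u => by
    have h1 : HasDerivAt (fun u : ℂ => sinh (s * u)) (cosh (s * u) * (s * 1)) u :=
      ((hasDerivAt_id u).const_mul (s : ℂ)).csinh
    have h2 : HasDerivAt (fun u : ℂ => u * (u ^ 2 + (ω : ℂ) ^ 2) * k u) _ u :=
      ((hasDerivAt_id u).mul (((hasDerivAt_id u).pow 2).add_const ((ω : ℂ) ^ 2))).mul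
        (hk u).hasDerivAt
    rw [← funext hfac] at h2
    have := h1.unique h2
    simp at this
    linear_combination this
  refine ⟨k, hk, hfac, fun u hu hk0 => ?_, ?_⟩
  · have hsu : sinh (s * u) = 0 := by rw [hfac, hk0, mul_zero]
    have hP : u * (u ^ 2 + (ω : ℂ) ^ 2) = 0 := by
      have hsI : sin (s * u * I) = 0 := by rw [Complex.sin_mul_I, hsu, zero_mul]
      obtain ⟨n, hn⟩ := Complex.sin_eq_zero_iff.1 hsI
      have hun : u = -(n * (ω * I)) := by
        have hsC : (s : ℂ) ≠ 0 := by exact_mod_cast hs.ne'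
        apply mul_left_cancel₀ hsC
        linear_combination (-I) * hn + s * u * I_sq + (n : ℂ) * I * hsω
      have him : u.im = -(n * ω) := by rw [hun]; simp
      rw [him, abs_neg, abs_mul, abs_of_pos hω0] at hu
      have hn2 : |(n : ℝ)| < 2 := lt_of_mul_lt_mul_right hu hω0.le
      have hn3 : |n| < 2 := by exact_mod_cast hn2
      have hn4 := abs_lt.1 hn3
      have : n = -1 ∨ n = 0 ∨ n = 1 := by omega
      rw [hun]
      rcases this with h | h | h <;> rw [h] <;> push_cast
      · linear_combination (ω : ℂ) ^ 3 * I * I_sq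
      · ring
      · linear_combination -(ω : ℂ) ^ 3 * I * I_sq
    have h1 := hder u
    rw [hk0, hP, mul_zero, zero_mul, add_zero] at h1
    have h2 := Complex.cosh_sq (s * u)
    have hsC : (s : ℂ) ≠ 0 := by exact_mod_cast hs.ne'
    rw [hsu, (mul_eq_zero.1 h1).resolve_left hsC] at h2
    norm_num at h2
  · have h1 := hder (I * ω)
    have h2 := hder (-(I * ω))
    rw [mul_neg, Complex.cosh_neg] at h2
    have h3 : (-2 * (ω : ℂ) ^ 2) * k (-(I * ω)) = (-2 * (ω : ℂ) ^ 2) * k (I * ω) := by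
      linear_combination h1 - h2 + ((3 * k (I * ω) + I * ω * deriv k (I * ω)
        - 3 * k (-(I * ω)) + I * ω * deriv k (-(I * ω))) * (ω : ℂ) ^ 2) * I_sq
    exact mul_left_cancel₀ (by simp [hωC]) h3

/-- The integral of `cos² / (ω² - x² sin²)²` over a period diverges as `x → ω⁻`. -/
theorem tendsto_integral_cos_sq_div_atTop {ω : ℝ} (hω : 0 < ω) :
    Tendsto (fun x : ℝ => ∫ θ in (0:ℝ)..(2 * π),
      Real.cos θ ^ 2 / (ω ^ 2 - x ^ 2 * Real.sin θ ^ 2) ^ 2) (𝓝[<] ω) atTop := by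
  have hδ : Tendsto (fun x : ℝ => √(ω ^ 2 - x ^ 2)) (𝓝[<] ω) (𝓝[>] 0) := by
    refine tendsto_nhdsWithin_iff.2 ⟨?_, ?_⟩
    · have : ContinuousAt (fun x : ℝ => √(ω ^ 2 - x ^ 2)) ω := by fun_prop
      have h := this.tendsto
      simp only [sub_self, Real.sqrt_zero] at h
      exact h.mono_left nhdsWithin_le_nhds
    · filter_upwards [Ioo_mem_nhdsLT hω] with x hx
      exact Real.sqrt_pos.2 (by nlinarith [hx.1, hx.2])
  have hc : 0 < 1 / (4 * (1 + 4 * ω ^ 2) ^ 2) := by positivity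
  refine tendsto_atTop_mono' _ ?_ ((tendsto_inv_nhdsGT_zero.comp hδ).const_mul_atTop hc)
  have hsmall : ∀ᶠ x in 𝓝[<] ω, √(ω ^ 2 - x ^ 2) < π / 4 :=
    (tendsto_nhdsWithin_iff.1 hδ).1.eventually_lt_const (by positivity)
  filter_upwards [Ioo_mem_nhdsLT hω, hsmall] with x hx hxs
  simp only [Function.comp_apply]
  set δ := √(ω ^ 2 - x ^ 2) with hδdef
  have hκ : 0 < ω ^ 2 - x ^ 2 := by nlinarith [hx.1, hx.2]
  have hδ0 : 0 < δ := Real.sqrt_pos.2 hκ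
  have hδ2 : δ ^ 2 = ω ^ 2 - x ^ 2 := Real.sq_sqrt hκ.le
  have hD : ∀ θ : ℝ, 0 < ω ^ 2 - x ^ 2 * Real.sin θ ^ 2 := fun θ => by
    nlinarith [Real.sin_sq_le_one θ, sq_nonneg x]
  have hcont : Continuous fun θ : ℝ => Real.cos θ ^ 2 / (ω ^ 2 - x ^ 2 * Real.sin θ ^ 2) ^ 2 :=
    Continuous.div (by fun_prop) (by fun_prop) fun θ => (pow_pos (hD θ) 2).ne'
  have hsub : ∫ θ in (π / 2 - 2 * δ)..(π / 2 - δ),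
        Real.cos θ ^ 2 / (ω ^ 2 - x ^ 2 * Real.sin θ ^ 2) ^ 2 ≤
      ∫ θ in (0:ℝ)..(2 * π), Real.cos θ ^ 2 / (ω ^ 2 - x ^ 2 * Real.sin θ ^ 2) ^ 2 := by
    refine intervalIntegral.integral_mono_interval (by linarith) (by linarith)
      (by linarith [Real.pi_pos]) (Eventually.of_forall fun θ => ?_) (hcont.intervalIntegrable _ _)
    simp only [Pi.zero_apply]
    positivity
  refine le_trans ?_ hsub
  have hlow : ∀ θ ∈ Icc (π / 2 - 2 * δ) (π / 2 - δ), 1 / (4 * (1 + 4 * ω ^ 2) ^ 2) / δ ^ 2 ≤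
      Real.cos θ ^ 2 / (ω ^ 2 - x ^ 2 * Real.sin θ ^ 2) ^ 2 := fun θ hθ => by
    have hcos : Real.cos θ = Real.sin (π / 2 - θ) := (Real.sin_pi_div_two_sub θ).symm
    have h1 : δ / 2 ≤ Real.cos θ := by
      rw [hcos]
      refine le_trans ?_ (Real.mul_le_sin (by linarith [hθ.2]) (by linarith [hθ.1]))
      have : 1 / 2 ≤ 2 / π := by
        rw [div_le_div_iff₀ (by norm_num) Real.pi_pos]; linarith [Real.pi_le_four]
      nlinarith [hθ.2]
    have h2 : Real.cos θ ≤ 2 * δ := by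
      rw [hcos]
      exact (Real.sin_le (by linarith [hθ.2])).trans (by linarith [hθ.1])
    have h3 : ω ^ 2 - x ^ 2 * Real.sin θ ^ 2 ≤ δ ^ 2 * (1 + 4 * ω ^ 2) := by
      have : Real.cos θ ^ 2 ≤ (2 * δ) ^ 2 := pow_le_pow_left₀ (by linarith) h2 2
      rw [Real.sin_sq]
      nlinarith [mul_le_mul_of_nonneg_left this (sq_nonneg x), sq_nonneg δ,
        mul_pos hκ (pow_pos hδ0 2)]
    have h4 : (ω ^ 2 - x ^ 2 * Real.sin θ ^ 2) ^ 2 ≤ (δ ^ 2 * (1 + 4 * ω ^ 2)) ^ 2 :=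
      pow_le_pow_left₀ (hD θ).le h3 2
    calc 1 / (4 * (1 + 4 * ω ^ 2) ^ 2) / δ ^ 2
        = (δ / 2) ^ 2 / (δ ^ 2 * (1 + 4 * ω ^ 2)) ^ 2 := by field_simp; norm_num
      _ ≤ _ := div_le_div₀ (by positivity) (pow_le_pow_left₀ (by positivity) h1 2)
          (pow_pos (hD θ) 2) h4
  have hconst := intervalIntegral.integral_mono_on (by linarith)
    (intervalIntegrable_const (μ := volume)) (hcont.intervalIntegrable _ _) hlow
  rw [intervalIntegral.integral_const, smul_eq_mul] at hconst
  refine le_trans (le_of_eq ?_) hconst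
  field_simp
  ring

theorem sq_sub_sq_mul_sin_sq_pos {ω x : ℝ} (hx : x ∈ Ioo (-ω) ω) (θ : ℝ) :
    0 < ω ^ 2 - x ^ 2 * Real.sin θ ^ 2 := by
  have : 0 < ω ^ 2 - x ^ 2 := by nlinarith [hx.1, hx.2]
  nlinarith [Real.sin_sq_le_one θ, sq_nonneg x]

theorem continuous_cos_sq_mul_div {ω x : ℝ} (hx : x ∈ Ioo (-ω) ω) {f : ℝ → ℂ}
    (hf : Continuous f) (n : ℕ) : Continuous fun θ : ℝ =>
      (Real.cos θ : ℂ) ^ 2 * f θ / ((ω : ℂ) ^ 2 - (x : ℂ) ^ 2 * (Real.sin θ : ℂ) ^ 2) ^ n :=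
  Continuous.div (by fun_prop) (by fun_prop) fun θ => pow_ne_zero n <| by
    exact_mod_cast (sq_sub_sq_mul_sin_sq_pos hx θ).ne'

section

variable {ω : ℝ} {B : ℝ × ℝ → ℂ}

/-- The `x`-derivative of `cos² θ * B (x, θ) / (ω² - x² sin² θ)`. -/
noncomputable def singularKernelDeriv (ω : ℝ) (B : ℝ × ℝ → ℂ) (x θ : ℝ) : ℂ :=
  (Real.cos θ : ℂ) ^ 2 * fderiv ℝ B (x, θ) (1, 0) /
      ((ω : ℂ) ^ 2 - (x : ℂ) ^ 2 * (Real.sin θ : ℂ) ^ 2) ^ 1 +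
    (Real.cos θ : ℂ) ^ 2 * (B (x, θ) * (2 * x * (Real.sin θ : ℂ) ^ 2)) /
      ((ω : ℂ) ^ 2 - (x : ℂ) ^ 2 * (Real.sin θ : ℂ) ^ 2) ^ 2

theorem continuousOn_fderiv_apply_fst
    (hB : ContDiffOn ℝ 1 B (Ioo (-(2 * ω)) (2 * ω) ×ˢ univ)) :
    ContinuousOn (fun q => fderiv ℝ B q (1, 0)) (Ioo (-(2 * ω)) (2 * ω) ×ˢ univ) :=
  (hB.continuousOn_fderiv_of_isOpen (isOpen_Ioo.prod isOpen_univ) le_rfl).clm_apply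
    continuousOn_const

theorem continuous_slice {E : Type*} [TopologicalSpace E] {f : ℝ × ℝ → E}
    (hf : ContinuousOn f (Ioo (-(2 * ω)) (2 * ω) ×ˢ univ)) {x : ℝ}
    (hx : x ∈ Ioo (-(2 * ω)) (2 * ω)) : Continuous fun θ : ℝ => f (x, θ) :=
  hf.comp_continuous (by fun_prop) fun _ => ⟨hx, mem_univ _⟩

theorem hasDerivAt_integral_singularKernel
    (hB : ContDiffOn ℝ 1 B (Ioo (-(2 * ω)) (2 * ω) ×ˢ univ)) {x : ℝ} (hx : x ∈ Ioo (-ω) ω) :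
    HasDerivAt (fun x : ℝ => ∫ θ in (0:ℝ)..(2 * π),
        (Real.cos θ : ℂ) ^ 2 * B (x, θ) /
          ((ω : ℂ) ^ 2 - (x : ℂ) ^ 2 * (Real.sin θ : ℂ) ^ 2) ^ 1)
      (∫ θ in (0:ℝ)..(2 * π), singularKernelDeriv ω B x θ) x := by
  have hsub : Ioo (-ω) ω ⊆ Ioo (-(2 * ω)) (2 * ω) := fun y hy =>
    ⟨by linarith [hy.1, hy.2], by linarith [hy.1, hy.2]⟩
  have hF : ∀ y ∈ Ioo (-ω) ω, Continuous fun θ : ℝ => (Real.cos θ : ℂ) ^ 2 * B (y, θ) /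
      ((ω : ℂ) ^ 2 - (y : ℂ) ^ 2 * (Real.sin θ : ℂ) ^ 2) ^ 1 := fun y hy =>
    continuous_cos_sq_mul_div hy (continuous_slice hB.continuousOn (hsub hy)) 1
  have hjoint : ContinuousOn (fun q : ℝ × ℝ => singularKernelDeriv ω B q.1 q.2)
      (Ioo (-ω) ω ×ˢ univ) := by
    have h1 := (continuousOn_fderiv_apply_fst hB).mono (prod_mono_left hsub)
    have h2 := hB.continuousOn.mono (prod_mono_left (t := univ) hsub)
    have h3 : ∀ n : ℕ, ∀ q ∈ Ioo (-ω) ω ×ˢ (univ : Set ℝ),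
        ((ω : ℂ) ^ 2 - (q.1 : ℂ) ^ 2 * (Real.sin q.2 : ℂ) ^ 2) ^ n ≠ 0 := fun n q hq =>
      pow_ne_zero n (by exact_mod_cast (sq_sub_sq_mul_sin_sq_pos hq.1 q.2).ne')
    unfold singularKernelDeriv
    exact ((ContinuousOn.mul (by fun_prop) h1).div (by fun_prop) (h3 1)).add
      ((ContinuousOn.mul (by fun_prop) (h2.mul (by fun_prop))).div (by fun_prop) (h3 2))
  obtain ⟨ε, hε, hεsub⟩ := Metric.nhds_basis_closedBall.mem_iff.1 (Ioo_mem_nhds hx.1 hx.2)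
  obtain ⟨C, hC⟩ := ((isCompact_closedBall x ε).prod
    (isCompact_Icc (a := (0:ℝ)) (b := 2 * π))).exists_bound_of_continuousOn
      (hjoint.mono (prod_mono hεsub (subset_univ _)))
  refine (intervalIntegral.hasDerivAt_integral_of_dominated_loc_of_deriv_le
    (bound := fun _ => C) (closedBall_mem_nhds x hε) ?_ ((hF x hx).intervalIntegrable _ _) ?_ ?_
    intervalIntegrable_const ?_).2
  · filter_upwards [Ioo_mem_nhds hx.1 hx.2] with y hy
    exact (hF y hy).aestronglyMeasurable
  · exact (hjoint.comp_continuous (f := fun θ : ℝ => (x, θ)) (by fun_prop)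
      fun _ => ⟨hx, mem_univ _⟩).aestronglyMeasurable
  · refine Eventually.of_forall fun θ hθ y hy => hC (y, θ) ⟨hy, ?_⟩
    rw [uIoc_of_le (by positivity)] at hθ
    exact Ioc_subset_Icc_self hθ
  · refine Eventually.of_forall fun θ _ y hy => ?_
    have hy' := hεsub hy
    have hD : ((ω : ℂ) ^ 2 - (y : ℂ) ^ 2 * (Real.sin θ : ℂ) ^ 2) ≠ 0 := by
      exact_mod_cast (sq_sub_sq_mul_sin_sq_pos hy' θ).ne'
    have hBd : HasDerivAt (fun y : ℝ => B (y, θ)) (fderiv ℝ B (y, θ) (1, 0)) y := by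
      have h1 : HasFDerivAt B (fderiv ℝ B (y, θ)) (y, θ) :=
        ((hB.differentiableOn one_ne_zero).differentiableAt
          ((isOpen_Ioo.prod isOpen_univ).mem_nhds ⟨hsub hy', mem_univ _⟩)).hasFDerivAt
      exact h1.comp_hasDerivAt y ((hasDerivAt_id y).prodMk (hasDerivAt_const y θ))
    have hDd : HasDerivAt (fun y : ℝ => ((ω : ℂ) ^ 2 - (y : ℂ) ^ 2 * (Real.sin θ : ℂ) ^ 2) ^ 1)
        (-(2 * y * (Real.sin θ : ℂ) ^ 2)) y := by
      have := (((hasDerivAt_id (y : ℂ)).comp_ofReal.pow 2).mul_const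
        ((Real.sin θ : ℂ) ^ 2)).const_sub ((ω : ℂ) ^ 2)
      simpa using this
    have := (hBd.const_mul ((Real.cos θ : ℂ) ^ 2)).div hDd (by simpa using hD)
    refine this.congr_deriv ?_
    unfold singularKernelDeriv
    field_simp
    ring

theorem exists_norm_sub_le_add_cos_sq (hω : 0 < ω) {C : ℝ × ℝ → ℂ}
    (hC : ContinuousOn C (Icc 0 ω ×ˢ Icc 0 (2 * π))) {c : ℂ} (hc : c ≠ 0)
    (h1 : C (ω, π / 2) = c) (h2 : C (ω, 3 * π / 2) = c) :
    ∃ M : ℝ, 0 ≤ M ∧ ∀ᶠ x in 𝓝[<] ω, ∀ θ ∈ Icc 0 (2 * π),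
      ‖C (x, θ) - c‖ ≤ ‖c‖ / 2 + M * Real.cos θ ^ 2 := by
  have hc' : 0 < ‖c‖ := norm_pos_iff.2 hc
  set S : Set (ℝ × ℝ) := Icc 0 ω ×ˢ Icc 0 (2 * π) with hS
  have hScomp : IsCompact S := isCompact_Icc.prod isCompact_Icc
  have hΦ : ContinuousOn (fun q => ‖C q - c‖) S := (hC.sub continuousOn_const).norm
  obtain ⟨A, hA⟩ := hScomp.exists_bound_of_continuousOn hΦ
  set T : Set (ℝ × ℝ) := S ∩ (fun q => ‖C q - c‖) ⁻¹' Ici (‖c‖ / 2) with hT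
  have hTcomp : IsCompact T :=
    hScomp.of_isClosed_subset (hΦ.preimage_isClosed_of_isClosed hScomp.isClosed isClosed_Ici)
      inter_subset_left
  have hψ : ContinuousOn (fun q : ℝ × ℝ => Real.cos q.2 ^ 2 + (ω - q.1)) T := by fun_prop
  obtain ⟨η, hη, hηT⟩ : ∃ η > 0, ∀ q ∈ T, η ≤ Real.cos q.2 ^ 2 + (ω - q.1) := by
    refine hTcomp.exists_forall_le' hψ fun q hq => ?_
    obtain ⟨x, θ⟩ := q
    obtain ⟨⟨⟨hx0, hx1⟩, hθ0, hθ1⟩, hq2⟩ := hq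
    simp only [mem_preimage, mem_Ici] at hx0 hx1 hθ0 hθ1 hq2 ⊢
    by_contra hneg
    have hcos : Real.cos θ = 0 := by
      have := sq_nonneg (Real.cos θ)
      exact pow_eq_zero_iff two_ne_zero |>.1 (by linarith)
    have hxω : x = ω := by
      have := sq_nonneg (Real.cos θ)
      linarith
    obtain ⟨n, hn⟩ := Real.cos_eq_zero_iff.1 hcos
    have hn0 : (-1 : ℝ) < n := by
      by_contra h
      nlinarith [Real.pi_pos]
    have hn1 : (n : ℝ) < 2 := by
      by_contra h
      nlinarith [Real.pi_pos]
    have hn0' : -1 < n := by exact_mod_cast hn0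
    have hn1' : n < 2 := by exact_mod_cast hn1
    have hn2 : n = 0 ∨ n = 1 := by omega
    have hCc : C (x, θ) = c := by
      rw [hxω]
      rcases hn2 with h | h
      · rw [hn, h, ← h1]; congr 2; push_cast; ring
      · rw [hn, h, ← h2]; congr 2; push_cast; ring
    rw [hCc, sub_self, norm_zero] at hq2
    linarith
  have hA0 : 0 ≤ A := (norm_nonneg _).trans (hA (0, 0) ⟨⟨le_rfl, hω.le⟩, le_rfl, by positivity⟩)
  refine ⟨2 * A / η, by positivity, ?_⟩
  filter_upwards [Ioo_mem_nhdsLT (show max 0 (ω - η / 2) < ω from max_lt hω (by linarith))]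
    with x hx θ hθ
  have hx0 : 0 < x := (le_max_left _ _).trans_lt hx.1
  have hx1 : ω - η / 2 < x := (le_max_right _ _).trans_lt hx.1
  have hqS : (x, θ) ∈ S := ⟨⟨hx0.le, hx.2.le⟩, hθ⟩
  by_cases hq : ‖c‖ / 2 ≤ ‖C (x, θ) - c‖
  · have h3 := hηT (x, θ) ⟨hqS, hq⟩
    have h4 := hA (x, θ) hqS
    simp only [norm_norm] at h3 h4
    have h5 : A ≤ 2 * A / η * Real.cos θ ^ 2 := by
      rw [div_mul_eq_mul_div, le_div_iff₀ hη]
      nlinarith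
    linarith
  · have : 0 ≤ 2 * A / η * Real.cos θ ^ 2 := by positivity
    linarith

theorem tendsto_norm_integral_singularKernelDeriv_atTop (hω : 0 < ω)
    (hB : ContDiffOn ℝ 1 B (Ioo (-(2 * ω)) (2 * ω) ×ˢ univ)) (hne : B (ω, π / 2) ≠ 0)
    (heq : B (ω, 3 * π / 2) = B (ω, π / 2)) :
    Tendsto (fun x : ℝ => ‖∫ θ in (0:ℝ)..(2 * π), singularKernelDeriv ω B x θ‖)
      (𝓝[<] ω) atTop := by
  set c : ℂ := B (ω, π / 2) * (2 * ω) with hcdef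
  have hc : c ≠ 0 := mul_ne_zero hne (by simpa using hω.ne')
  have hc' : 0 < ‖c‖ := norm_pos_iff.2 hc
  have hsub : Icc 0 ω ×ˢ Icc 0 (2 * π) ⊆ Ioo (-(2 * ω)) (2 * ω) ×ˢ univ :=
    prod_mono (fun y hy => ⟨by linarith [hy.1], by linarith [hy.2]⟩) (subset_univ _)
  obtain ⟨M₁, hM₁⟩ := (isCompact_Icc.prod isCompact_Icc).exists_bound_of_continuousOn
    ((continuousOn_fderiv_apply_fst hB).mono hsub)
  obtain ⟨M, hM, hMx⟩ := exists_norm_sub_le_add_cos_sq hω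
    (C := fun q => B q * (2 * q.1 * (Real.sin q.2 : ℂ) ^ 2)) (c := c)
    ((hB.continuousOn.mono hsub).mul (by fun_prop)) hc (by simp [hcdef])
    (by
      have : Real.sin (3 * π / 2) = -1 := by
        rw [show 3 * π / 2 = π / 2 + π by ring, Real.sin_add_pi, Real.sin_pi_div_two]
      simp only [heq, this]
      push_cast
      rw [hcdef]; ring)
  have hlow := tendsto_atTop_add_const_right _ (-(2 * π * (M₁ / ω ^ 2 + M / ω ^ 4)))
    ((tendsto_integral_cos_sq_div_atTop hω).const_mul_atTop (show 0 < ‖c‖ / 2 by positivity))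
  refine tendsto_atTop_mono' _ ?_ hlow
  filter_upwards [Ioo_mem_nhdsLT hω, hMx] with x hx hMx
  have hx' : x ∈ Ioo (-ω) ω := ⟨by linarith [hx.1], hx.2⟩
  have hx'' : x ∈ Ioo (-(2 * ω)) (2 * ω) := ⟨by linarith [hx.1], by linarith [hx.2]⟩
  set k : ℝ → ℝ := fun θ => Real.cos θ ^ 2 / (ω ^ 2 - x ^ 2 * Real.sin θ ^ 2) ^ 2 with hk
  have hkcont : Continuous k := Continuous.div (by fun_prop) (by fun_prop) fun θ =>
    (pow_pos (sq_sub_sq_mul_sin_sq_pos hx' θ) 2).ne'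
  have hgcont : Continuous (singularKernelDeriv ω B x) :=
    (continuous_cos_sq_mul_div hx' (continuous_slice (continuousOn_fderiv_apply_fst hB) hx'')
      1).add (continuous_cos_sq_mul_div hx' (f := fun θ => B (x, θ) * (2 * x * (Real.sin θ : ℂ) ^ 2))
        ((continuous_slice hB.continuousOn hx'').mul (by fun_prop)) 2)
  have hpt : ∀ θ ∈ Icc 0 (2 * π), ‖singularKernelDeriv ω B x θ - c * (k θ : ℂ)‖ ≤
      (M₁ / ω ^ 2 + M / ω ^ 4) + ‖c‖ / 2 * k θ := fun θ hθ => by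
    have hD := sq_sub_sq_mul_sin_sq_pos hx' θ
    set D : ℝ := ω ^ 2 - x ^ 2 * Real.sin θ ^ 2 with hDdef
    have hDω : ω ^ 2 * Real.cos θ ^ 2 ≤ D := by
      rw [hDdef, Real.cos_sq']
      have : x ^ 2 ≤ ω ^ 2 := pow_le_pow_left₀ hx.1.le hx.2.le 2
      nlinarith [mul_le_mul_of_nonneg_right this (sq_nonneg (Real.sin θ))]
    have hM₁' := hM₁ (x, θ) ⟨⟨hx.1.le, hx.2.le⟩, hθ⟩
    have hM' := hMx θ hθ
    have hk0 : 0 ≤ k θ := by rw [hk]; positivity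
    have hkcos : k θ * Real.cos θ ^ 2 ≤ 1 / ω ^ 4 := by
      have h6 : (ω ^ 2 * Real.cos θ ^ 2) ^ 2 ≤ D ^ 2 := pow_le_pow_left₀ (by positivity) hDω 2
      simp only [hk]
      rw [div_mul_eq_mul_div, div_le_div_iff₀ (pow_pos hD 2) (by positivity)]
      linarith
    have hcosD : Real.cos θ ^ 2 / D ≤ 1 / ω ^ 2 := by
      rw [div_le_div_iff₀ hD (by positivity)]
      linarith
    have hsplit : singularKernelDeriv ω B x θ - c * (k θ : ℂ) =
        ((Real.cos θ ^ 2 / D : ℝ) : ℂ) * fderiv ℝ B (x, θ) (1, 0) +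
          (k θ : ℂ) * (B (x, θ) * (2 * x * (Real.sin θ : ℂ) ^ 2) - c) := by
      simp only [singularKernelDeriv, hk, hDdef]
      push_cast
      ring
    rw [hsplit]
    refine (norm_add_le _ _).trans ?_
    rw [norm_mul, norm_mul, Complex.norm_real, Complex.norm_real,
      Real.norm_of_nonneg (by positivity), Real.norm_of_nonneg hk0]
    have e1 : Real.cos θ ^ 2 / D * ‖fderiv ℝ B (x, θ) (1, 0)‖ ≤ 1 / ω ^ 2 * M₁ :=
      mul_le_mul hcosD hM₁' (norm_nonneg _) (by positivity)
    have e2 := mul_le_mul_of_nonneg_left hM' hk0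
    have e3 := mul_le_mul_of_nonneg_left hkcos hM
    calc _ ≤ 1 / ω ^ 2 * M₁ + k θ * (‖c‖ / 2 + M * Real.cos θ ^ 2) := add_le_add e1 e2
      _ = 1 / ω ^ 2 * M₁ + M * (k θ * Real.cos θ ^ 2) + ‖c‖ / 2 * k θ := by ring
      _ ≤ 1 / ω ^ 2 * M₁ + M * (1 / ω ^ 4) + ‖c‖ / 2 * k θ := by gcongr
      _ = _ := by ring
  have hpi : (0 : ℝ) ≤ 2 * π := by positivity
  have hker := intervalIntegral.norm_integral_le_of_norm_le (μ := volume) hpi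
    (Eventually.of_forall fun θ hθ => hpt θ (Ioc_subset_Icc_self hθ))
    (Continuous.intervalIntegrable (by fun_prop) _ _)
  rw [intervalIntegral.integral_sub (hgcont.intervalIntegrable _ _)
    (Continuous.intervalIntegrable (by fun_prop) _ _),
    intervalIntegral.integral_const_mul, intervalIntegral.integral_ofReal,
    intervalIntegral.integral_add intervalIntegrable_const
      (Continuous.intervalIntegrable (by fun_prop) _ _),
    intervalIntegral.integral_const, intervalIntegral.integral_const_mul, smul_eq_mul,
    sub_zero] at hker
  have hI : 0 ≤ ∫ θ in (0:ℝ)..(2 * π), k θ :=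
    intervalIntegral.integral_nonneg hpi fun θ _ => by simp only [hk]; positivity
  have htri := norm_sub_norm_le (c * ((∫ θ in (0:ℝ)..(2 * π), k θ : ℝ) : ℂ))
    (∫ θ in (0:ℝ)..(2 * π), singularKernelDeriv ω B x θ)
  rw [norm_sub_rev, norm_mul, Complex.norm_real, Real.norm_of_nonneg hI] at htri
  linarith

end

theorem exists_even_eq_mul_of_odd {f : ℂ → ℂ} (hf : Differentiable ℂ f)
    (hodd : ∀ u, f (-u) = -f u) {d : ℂ} (hd : HasDerivAt f d 0) (hd0 : d ≠ 0) :
    ∃ h : ℂ → ℂ, Differentiable ℂ h ∧ (∀ u, f u = u * h u) ∧ (∀ u, h (-u) = h u) ∧ h 0 ≠ 0 := by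
  have hf0 : f 0 = 0 := by
    have := hodd 0
    rw [neg_zero] at this
    linear_combination this / 2
  obtain ⟨h, hh, hfh⟩ := exists_eq_sub_mul_of_differentiable hf hf0
  simp only [sub_zero] at hfh
  refine ⟨h, hh, hfh, fun u => ?_, ?_⟩
  · rcases eq_or_ne u 0 with rfl | hu
    · rw [neg_zero]
    · have := hodd u
      rw [hfh, hfh] at this
      exact mul_left_cancel₀ hu (by linear_combination -this)
  · have h1 : HasDerivAt (fun u : ℂ => u * h u) _ 0 := (hasDerivAt_id (0 : ℂ)).mul (hh 0).hasDerivAt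
    rw [← funext hfh] at h1
    have := hd.unique h1
    simp only [one_mul, id, zero_mul, add_zero] at this
    rwa [← this]

theorem isOpen_setOf_abs_im_lt (r : ℝ) : IsOpen {u : ℂ | |u.im| < r} :=
  isOpen_lt (by fun_prop) continuous_const

/-- The double zero and the first pair of poles of `Fmpz` split off. -/
theorem exists_Fmpz_eq {m p : ℕ} (hm : 2 ≤ m) (hp : 2 ≤ p) (z : ℂ) {ω : ℝ}
    (hω : ω = π / √((m : ℝ) * (p : ℝ))) :
    ∃ R : ℂ → ℂ, DifferentiableOn ℂ R {u : ℂ | |u.im| < 2 * ω} ∧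
      (∀ u, Fmpz m p z u = u ^ 2 / (u ^ 2 + (ω : ℂ) ^ 2) * R u) ∧ R 0 ≠ 0 ∧
      R (-(I * ω)) = R (I * ω) ∧
      ((¬ ∃ n : ℤ, n ≠ 0 ∧ 2 * z + 1 = (n : ℂ)) → R (I * ω) ≠ 0) := by
  have hm0 : (0 : ℝ) < m := by exact_mod_cast (show 0 < m by omega)
  have hp0 : (0 : ℝ) < p := by exact_mod_cast (show 0 < p by omega)
  set s : ℝ := √((m : ℝ) * (p : ℝ)) with hs
  set a : ℝ := √((m : ℝ) / (p : ℝ)) with ha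
  set b : ℝ := √((p : ℝ) / (m : ℝ)) with hb
  have hs0 : 0 < s := Real.sqrt_pos.2 (by positivity)
  have ha0 : 0 < a := Real.sqrt_pos.2 (by positivity)
  have hb0 : 0 < b := Real.sqrt_pos.2 (by positivity)
  have hsa : s = p * a := by
    rw [hs, ha, show (m : ℝ) * p = p ^ 2 * (m / p) by field_simp, Real.sqrt_mul (by positivity),
      Real.sqrt_sq hp0.le]
  have hsb : s = m * b := by
    rw [hs, hb, show (m : ℝ) * p = m ^ 2 * (p / m) by field_simp, Real.sqrt_mul (by positivity),
      Real.sqrt_sq hm0.le]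
  have hω0 : 0 < ω := by rw [hω]; positivity
  have hωC : (ω : ℂ) ≠ 0 := by exact_mod_cast hω0.ne'
  have hsC : (s : ℂ) ≠ 0 := by exact_mod_cast hs0.ne'
  have hsω : s * ω = π := by rw [hω]; field_simp
  set T : ℂ → ℂ := fun u => if 2 * z + 1 = 0 then (s : ℂ) * u
    else sinh ((2 * z + 1) * (s : ℂ) * u) / (2 * z + 1) with hT
  have hsinh : ∀ c : ℂ, HasDerivAt (fun u : ℂ => sinh (c * u)) c 0 := fun c => by
    simpa using ((hasDerivAt_id (0 : ℂ)).const_mul c).csinh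
  have hTdiff : Differentiable ℂ T := by
    by_cases h : 2 * z + 1 = 0
    · simp only [hT, h, if_true]; fun_prop
    · simp only [hT, h, if_false]; fun_prop
  have hTodd : ∀ u, T (-u) = -T u := fun u => by
    simp only [hT]
    split_ifs
    · ring
    · rw [mul_neg, Complex.sinh_neg, neg_div]
  have hTder : HasDerivAt T s 0 := by
    by_cases h : 2 * z + 1 = 0
    · simp only [hT, h, if_true]
      simpa using (hasDerivAt_id (0 : ℂ)).const_mul (s : ℂ)
    · simp only [hT, h, if_false]
      simpa [h] using (hsinh ((2 * z + 1) * s)).div_const (2 * z + 1)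
  obtain ⟨H, hH, hHu, hHev, hH0⟩ := exists_even_eq_mul_of_odd hTdiff hTodd hTder hsC
  obtain ⟨A, hA, hAu, hAev, hA0⟩ := exists_even_eq_mul_of_odd
    (f := fun u => sinh ((a : ℂ) * u)) (by fun_prop)
    (fun u => by simp only [mul_neg, Complex.sinh_neg]) (hsinh a) (by exact_mod_cast ha0.ne')
  obtain ⟨B, hB, hBu, hBev, hB0⟩ := exists_even_eq_mul_of_odd
    (f := fun u => sinh ((b : ℂ) * u)) (by fun_prop)
    (fun u => by simp only [mul_neg, Complex.sinh_neg]) (hsinh b) (by exact_mod_cast hb0.ne')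
  obtain ⟨k, hk, hku, hk0, hkev⟩ := exists_sinh_mul_eq hs0
  rw [← hω] at hkev hk0 hku
  have hkω : k (I * ω) ≠ 0 := hk0 _ (by simp [abs_of_pos hω0, hω0])
  have hreal : ∀ (c : ℝ) (n : ℕ), 2 ≤ n → s = n * c → sinh ((c : ℂ) * (I * ω)) ≠ 0 := by
    intro c n hn hsc h
    have hn0 : (2 : ℝ) ≤ n := by exact_mod_cast hn
    have hcω : c * ω = π / n := by
      rw [eq_div_iff (by positivity), ← hsω, hsc]; ring
    rw [show (c : ℂ) * (I * ω) = ((c * ω : ℝ) : ℂ) * I by push_cast; ring, Complex.sinh_mul_I,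
      mul_eq_zero, or_iff_left I_ne_zero, ← Complex.ofReal_sin, Complex.ofReal_eq_zero,
      hcω] at h
    refine (Real.sin_pos_of_pos_of_lt_pi (by positivity) ?_).ne' h
    rw [div_lt_iff₀ (by positivity)]
    nlinarith [Real.pi_pos]
  refine ⟨fun u => H u * A u * B u / k u, ?_, fun u => ?_, ?_, ?_, fun hz => ?_⟩
  · exact ((hH.mul hA).mul hB).differentiableOn.div hk.differentiableOn fun u hu => hk0 u hu
  · have hF : Fmpz m p z u = T u * sinh (a * u) * sinh (b * u) / sinh (s * u) := rfl
    rw [hF, hHu, hku, hAu u, hBu u]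
    rcases eq_or_ne u 0 with rfl | hu
    · simp
    · rw [show u * H u * (u * A u) * (u * B u) = u * (u ^ 2 * (H u * A u * B u)) by ring,
        mul_assoc u, mul_div_mul_left _ _ hu, div_mul_div_comm]
  · exact div_ne_zero (mul_ne_zero (mul_ne_zero hH0 hA0) hB0) (hk0 0 (by simp [hω0]))
  · simp only [hHev, hAev, hBev, hkev]
  · have hTω : T (I * ω) ≠ 0 := by
      by_cases h : 2 * z + 1 = 0
      · simp [hT, h, hsC, hωC]
      · simp only [hT, h, if_false]
        refine div_ne_zero (fun h0 => ?_) h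
        rw [show (2 * z + 1) * (s : ℂ) * (I * ω) = (2 * z + 1) * ((s * ω : ℝ) : ℂ) * I by
          push_cast; ring, hsω, Complex.sinh_mul_I, mul_eq_zero, or_iff_left I_ne_zero,
          Complex.sin_eq_zero_iff] at h0
        obtain ⟨n, hn⟩ := h0
        have hzn := mul_right_cancel₀ (by exact_mod_cast Real.pi_ne_zero) hn
        refine hz ⟨n, fun hn0 => h ?_, hzn⟩
        rw [hzn, hn0, Int.cast_zero]
    have hAω := hreal a p hp hsa
    have hBω := hreal b m hm hsb
    rw [hAu] at hAω
    rw [hBu] at hBω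
    rw [hHu] at hTω
    exact div_ne_zero (mul_ne_zero (mul_ne_zero (right_ne_zero_of_mul hTω)
      (right_ne_zero_of_mul hAω)) (right_ne_zero_of_mul hBω)) hkω

/-- A function on `ℝ` whose derivative is unbounded on the left of a point has no analytic
extension to a neighbourhood of that point. -/
theorem not_analyticAt_of_tendsto_norm_deriv_atTop {G g' : ℝ → ℂ} {ω : ℝ}
    (hG : ∀ᶠ x in 𝓝[<] ω, HasDerivAt G (g' x) x)
    (hg' : Tendsto (fun x => ‖g' x‖) (𝓝[<] ω) atTop) :
    ¬ ∃ Gext : ℂ → ℂ, AnalyticAt ℂ Gext (ω : ℂ) ∧ ∀ᶠ x : ℝ in 𝓝[<] ω, Gext (x : ℂ) = G x := by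
  rintro ⟨Gext, hext, heq⟩
  have hofReal : Tendsto (fun x : ℝ => (x : ℂ)) (𝓝[<] ω) (𝓝 (ω : ℂ)) :=
    Complex.continuous_ofReal.continuousAt.tendsto.mono_left nhdsWithin_le_nhds
  have hlim : Tendsto (fun x : ℝ => ‖deriv Gext x‖) (𝓝[<] ω) (𝓝 ‖deriv Gext ω‖) :=
    (hext.deriv.continuousAt.tendsto.comp hofReal).norm
  refine not_tendsto_nhds_of_tendsto_atTop hg' _ (hlim.congr' ?_)
  filter_upwards [hG, hofReal.eventually hext.eventually_analyticAt,
    eventually_eventually_nhdsWithin.2 heq, self_mem_nhdsWithin] with x hx hxa hxe hxω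
  have h1 : HasDerivAt (fun y : ℝ => Gext y) (deriv Gext x) x :=
    hxa.differentiableAt.hasDerivAt.comp_ofReal
  rw [IsOpen.nhdsWithin_eq isOpen_Iio hxω] at hxe
  rw [h1.unique (hx.congr_of_eventuallyEq hxe)]

/-- If `2w+1` is not a non-zero integer then, with `w₀ = π/√(mp)`,
`G_{m,p,z,w}` is defined and differentiable on `[0, w₀)`, its derivative blows up in
norm as `x → w₀⁻`, and `G_{m,p,z,w}` admits no analytic extension to a neighbourhood
of `w₀`. -/
theorem stmt7 (m p : ℕ) (hm : 2 ≤ m) (hp : 2 ≤ p) (hcop : Nat.Coprime m p)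
    (z w : ℂ) (hw : ¬ ∃ n : ℤ, n ≠ 0 ∧ 2 * w + 1 = (n : ℂ)) :
    (∀ x : ℝ, x ∈ Set.Ico (0 : ℝ) (Real.pi / Real.sqrt ((m : ℝ) * (p : ℝ))) →
      IntervalIntegrable
        (fun θ : ℝ => Fmpz m p z ((x : ℂ) * (Real.cos θ : ℂ)) *
          Fmpz m p w (Complex.I * (x : ℂ) * (Real.sin θ : ℂ)))
        volume 0 (2 * Real.pi)) ∧
    ∃ g' : ℝ → ℂ,
      (∀ x : ℝ, x ∈ Set.Ico (0 : ℝ) (Real.pi / Real.sqrt ((m : ℝ) * (p : ℝ))) →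
        HasDerivWithinAt (fun x : ℝ =>
            ∫ θ in (0:ℝ)..(2 * Real.pi), Fmpz m p z ((x : ℂ) * (Real.cos θ : ℂ)) *
              Fmpz m p w (Complex.I * (x : ℂ) * (Real.sin θ : ℂ)))
          (g' x) (Set.Ico (0 : ℝ) (Real.pi / Real.sqrt ((m : ℝ) * (p : ℝ)))) x) ∧
      Tendsto (fun x : ℝ => ‖g' x‖)
        (𝓝[<] (Real.pi / Real.sqrt ((m : ℝ) * (p : ℝ)))) atTop ∧
      ¬ ∃ Gext : ℂ → ℂ,
          AnalyticAt ℂ Gext ((Real.pi / Real.sqrt ((m : ℝ) * (p : ℝ)) : ℝ) : ℂ) ∧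
          ∀ᶠ x : ℝ in 𝓝[<] (Real.pi / Real.sqrt ((m : ℝ) * (p : ℝ))),
            Gext (x : ℂ) =
              ∫ θ in (0:ℝ)..(2 * Real.pi), Fmpz m p z ((x : ℂ) * (Real.cos θ : ℂ)) *
                Fmpz m p w (Complex.I * (x : ℂ) * (Real.sin θ : ℂ)) := by
  set ω : ℝ := π / √((m : ℝ) * (p : ℝ)) with hω
  have hm0 : (0 : ℝ) < m := by exact_mod_cast (show 0 < m by omega)
  have hp0 : (0 : ℝ) < p := by exact_mod_cast (show 0 < p by omega)
  have hω0 : 0 < ω := by rw [hω]; positivity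
  obtain ⟨R, hR, hFR, hR0, -, -⟩ := exists_Fmpz_eq hm hp z hω
  obtain ⟨S, hS, hFS, -, hSev, hSω⟩ := exists_Fmpz_eq hm hp w hω
  set B : ℝ × ℝ → ℂ := fun q =>
    (q.1 : ℂ) ^ 2 * (R ((q.1 : ℂ) * (Real.cos q.2 : ℂ)) *
      (((q.1 : ℂ) * (Real.cos q.2 : ℂ)) ^ 2 + (ω : ℂ) ^ 2)⁻¹) *
    (-((q.1 : ℂ) * (Real.sin q.2 : ℂ)) ^ 2 * S (I * (q.1 : ℂ) * (Real.sin q.2 : ℂ))) with hBdef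
  have hker : ∀ x θ : ℝ, Fmpz m p z ((x : ℂ) * (Real.cos θ : ℂ)) *
      Fmpz m p w (I * (x : ℂ) * (Real.sin θ : ℂ)) = (Real.cos θ : ℂ) ^ 2 * B (x, θ) /
        ((ω : ℂ) ^ 2 - (x : ℂ) ^ 2 * (Real.sin θ : ℂ) ^ 2) ^ 1 := fun x θ => by
    rw [hFR, hFS, show (I * (x : ℂ) * (Real.sin θ : ℂ)) ^ 2 + (ω : ℂ) ^ 2 =
      ((ω : ℂ) ^ 2 - (x : ℂ) ^ 2 * (Real.sin θ : ℂ) ^ 2) ^ 1 by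
        linear_combination ((x : ℂ) ^ 2 * (Real.sin θ : ℂ) ^ 2) * I_sq,
      mul_assoc I, mul_pow I, I_sq]
    simp only [hBdef, mul_assoc I]
    ring
  have hofReal : ContDiff ℝ 1 fun x : ℝ => (x : ℂ) := Complex.ofRealCLM.contDiff
  have hx1 : ContDiff ℝ 1 fun q : ℝ × ℝ => (q.1 : ℂ) := hofReal.comp contDiff_fst
  have hcos : ContDiff ℝ 1 fun q : ℝ × ℝ => (Real.cos q.2 : ℂ) :=
    hofReal.comp (Real.contDiff_cos.comp contDiff_snd)
  have hsin : ContDiff ℝ 1 fun q : ℝ × ℝ => (Real.sin q.2 : ℂ) :=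
    hofReal.comp (Real.contDiff_sin.comp contDiff_snd)
  have hRB : ContDiffOn ℝ 1 (fun q : ℝ × ℝ => R ((q.1 : ℂ) * (Real.cos q.2 : ℂ)))
      (Ioo (-(2 * ω)) (2 * ω) ×ˢ univ) :=
    ((hR.contDiffOn (n := 1) (isOpen_setOf_abs_im_lt _)).restrict_scalars ℝ).comp
      (hx1.mul hcos).contDiffOn fun q _ => by simpa [← Complex.ofReal_mul, -ofReal_cos] using hω0
  have hSB : ContDiffOn ℝ 1 (fun q : ℝ × ℝ => S (I * (q.1 : ℂ) * (Real.sin q.2 : ℂ)))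
      (Ioo (-(2 * ω)) (2 * ω) ×ˢ univ) :=
    ((hS.contDiffOn (n := 1) (isOpen_setOf_abs_im_lt _)).restrict_scalars ℝ).comp
      ((contDiff_const.mul hx1).mul hsin).contDiffOn fun q hq => by
        have h1 : |q.1| < 2 * ω := abs_lt.2 hq.1
        have h2 : |q.1 * Real.sin q.2| ≤ |q.1| := by
          rw [abs_mul]
          exact mul_le_of_le_one_right (abs_nonneg _) (Real.abs_sin_le_one _)
        rw [mul_assoc, ← Complex.ofReal_mul]
        simpa [-ofReal_sin] using h2.trans_lt h1
  have hden : ∀ q : ℝ × ℝ, ((q.1 : ℂ) * (Real.cos q.2 : ℂ)) ^ 2 + (ω : ℂ) ^ 2 ≠ 0 := fun q => by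
    exact_mod_cast (show (q.1 * Real.cos q.2) ^ 2 + ω ^ 2 ≠ 0 by positivity)
  have hB : ContDiffOn ℝ 1 B (Ioo (-(2 * ω)) (2 * ω) ×ˢ univ) :=
    ((hx1.pow 2).contDiffOn.mul
      (hRB.mul ((((hx1.mul hcos).pow 2).add contDiff_const).inv hden).contDiffOn)).mul
        (((hx1.mul hsin).pow 2).neg.contDiffOn.mul hSB)
  have hne : B (ω, π / 2) ≠ 0 := by
    simp [hBdef, hω0.ne', hR0, hSω hw]
  have heq : B (ω, 3 * π / 2) = B (ω, π / 2) := by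
    have h1 : Real.sin (3 * π / 2) = -1 := by
      rw [show 3 * π / 2 = π / 2 + π by ring, Real.sin_add_pi, Real.sin_pi_div_two]
    have h2 : Real.cos (3 * π / 2) = 0 := by
      rw [show 3 * π / 2 = π / 2 + π by ring, Real.cos_add_pi, Real.cos_pi_div_two, neg_zero]
    simp only [hBdef, h1, h2, Real.sin_pi_div_two, Real.cos_pi_div_two]
    push_cast
    rw [mul_neg_one (I * (ω : ℂ)), hSev]
    ring_nf
  have hsub : ∀ x ∈ Ico 0 ω, x ∈ Ioo (-ω) ω := fun x hx => ⟨by linarith [hx.1], hx.2⟩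
  simp only [hker]
  have hder := fun x (hx : x ∈ Ioo (-ω) ω) => hasDerivAt_integral_singularKernel hB hx
  have hblow := tendsto_norm_integral_singularKernelDeriv_atTop hω0 hB hne heq
  refine ⟨fun x hx => ?_, fun x => ∫ θ in (0:ℝ)..(2 * π), singularKernelDeriv ω B x θ,
    fun x hx => (hder x (hsub x hx)).hasDerivWithinAt, hblow,
    not_analyticAt_of_tendsto_norm_deriv_atTop ?_ hblow⟩
  · exact (continuous_cos_sq_mul_div (hsub x hx) (continuous_slice hB.continuousOn
      ⟨by linarith [hx.1], by linarith [hx.2]⟩) 1).intervalIntegrable _ _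
  · filter_upwards [Ioo_mem_nhdsLT (show -ω < ω by linarith)] with x hx using hder x hx
end

section
/- Let m, p be coprime integers with m ≥ 2 and p ≥ 2, and let z, w ∈ ℂ be such that 2z+1 is not a non-zero integer or 2w+1 is not a non-zero integer. Then the power series Σ_{k≥2} P_{m,p,z,w}(k) · k! · h^{k+1} in the variable h has radius of convergence equal to 0. -/
open Complex Filter MeasureTheory Metric Set Topology
open scoped Real Nat Classical

lemma pow_series_unique (d : ℕ → ℂ)
    (hd : ∀ᶠ x in 𝓝 (0 : ℂ), HasSum (fun k : ℕ => d k * x ^ (2 * (k + 2))) 0) (k : ℕ) :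
    d k = 0 := by
  set e : ℕ → ℂ := fun n => if n < 2 then 0 else d (n - 2) with he
  have h1 : ∀ᶠ t in 𝓝 (0 : ℂ), HasSum (fun n : ℕ => t ^ n • e n) 0 := by
    obtain ⟨δ, hδ, H⟩ := Metric.eventually_nhds_iff.mp hd
    refine Metric.eventually_nhds_iff.mpr ⟨δ ^ 2, by positivity, fun {t} ht => ?_⟩
    obtain ⟨x, hx⟩ := IsAlgClosed.exists_pow_nat_eq t (n := 2) (by norm_num)
    have hxd : dist x 0 < δ := by
      rw [dist_zero_right] at ht ⊢
      rw [← hx, norm_pow] at ht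
      exact lt_of_pow_lt_pow_left₀ 2 hδ.le ht
    have := H hxd
    rw [← hasSum_nat_add_iff' 2]
    have e1 : (fun n => t ^ (n + 2) • e (n + 2)) = fun k => d k * x ^ (2 * (k + 2)) := by
      funext n
      simp [he, ← hx, pow_mul, mul_comm]
    have e2 : (0 : ℂ) - ∑ i ∈ Finset.range 2, t ^ i • e i = 0 := by
      simp [he, Finset.sum_range_succ]
    rw [e1, e2]
    exact this
  have h2 : HasFPowerSeriesAt (fun _ : ℂ => (0 : ℂ)) (FormalMultilinearSeries.ofScalars ℂ e) 0 := by
    rw [hasFPowerSeriesAt_iff]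
    simpa using h1
  have h3 := h2.eq_zero
  have h4 : (FormalMultilinearSeries.ofScalars ℂ e).coeff (k + 2) = 0 := by
    rw [h3]; rfl
  simpa [he] using h4

/-- The normalised half-integer Gamma values `Γ(n + 1/2) / Γ(1/2)`. -/
noncomputable def gammaHalf : ℕ → ℝ
  | 0 => 1
  | n + 1 => (n + 1 / 2) * gammaHalf n

lemma gammaHalf_pos (n : ℕ) : 0 < gammaHalf n := by
  induction n with
  | zero => simp [gammaHalf]
  | succ n ih => rw [gammaHalf]; positivity

lemma integral_cos_sin_parts (a b : ℕ) :
    (2 * b + 1) * ∫ θ in (0:ℝ)..(2 * π), Real.cos θ ^ (2 * (a + 1)) * Real.sin θ ^ (2 * b) =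
    (2 * a + 1) * ∫ θ in (0:ℝ)..(2 * π), Real.cos θ ^ (2 * a) * Real.sin θ ^ (2 * (b + 1)) := by
  have h : ∀ θ : ℝ, HasDerivAt (fun θ : ℝ => Real.cos θ ^ (2 * a + 1) * Real.sin θ ^ (2 * b + 1))
      ((2 * b + 1) * (Real.cos θ ^ (2 * (a + 1)) * Real.sin θ ^ (2 * b)) -
        (2 * a + 1) * (Real.cos θ ^ (2 * a) * Real.sin θ ^ (2 * (b + 1)))) θ := by
    intro θ
    refine (((Real.hasDerivAt_cos θ).pow (2 * a + 1)).mul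
      ((Real.hasDerivAt_sin θ).pow (2 * b + 1))).congr_deriv ?_
    simp only [Nat.add_sub_cancel, Pi.pow_apply]
    push_cast
    ring
  have key := intervalIntegral.integral_eq_sub_of_hasDerivAt (a := 0) (b := 2 * π)
    (fun θ _ => h θ) (Continuous.intervalIntegrable (by fun_prop) _ _)
  rw [intervalIntegral.integral_sub (Continuous.intervalIntegrable (by fun_prop) _ _)
    (Continuous.intervalIntegrable (by fun_prop) _ _), intervalIntegral.integral_const_mul,
    intervalIntegral.integral_const_mul] at key
  simp at key
  linarith

lemma integral_cos_sin_add (a b : ℕ) :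
    (∫ θ in (0:ℝ)..(2 * π), Real.cos θ ^ (2 * (a + 1)) * Real.sin θ ^ (2 * b)) +
    (∫ θ in (0:ℝ)..(2 * π), Real.cos θ ^ (2 * a) * Real.sin θ ^ (2 * (b + 1))) =
    ∫ θ in (0:ℝ)..(2 * π), Real.cos θ ^ (2 * a) * Real.sin θ ^ (2 * b) := by
  rw [← intervalIntegral.integral_add (Continuous.intervalIntegrable (by fun_prop) _ _)
    (Continuous.intervalIntegrable (by fun_prop) _ _)]
  refine intervalIntegral.integral_congr fun θ _ => ?_
  simp only [mul_add, pow_add, mul_one]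
  linear_combination (Real.cos θ ^ (2 * a) * Real.sin θ ^ (2 * b)) * Real.cos_sq_add_sin_sq θ

lemma integral_cos_sin (a b : ℕ) :
    ((a + b).factorial : ℝ) * ∫ θ in (0:ℝ)..(2 * π), Real.cos θ ^ (2 * a) * Real.sin θ ^ (2 * b) =
      2 * π * gammaHalf a * gammaHalf b := by
  have key : ∀ a b : ℕ,
      ((a : ℝ) + b + 1) * ∫ θ in (0:ℝ)..(2 * π), Real.cos θ ^ (2 * (a + 1)) * Real.sin θ ^ (2 * b) =
      (a + 1 / 2) * ∫ θ in (0:ℝ)..(2 * π), Real.cos θ ^ (2 * a) * Real.sin θ ^ (2 * b) := by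
    intro a b
    linear_combination (1 / 2) * integral_cos_sin_parts a b
      + (a + 1 / 2) * integral_cos_sin_add a b
  induction a with
  | succ a ih =>
    rw [show a + 1 + b = a + b + 1 by ring, Nat.factorial_succ, gammaHalf]
    push_cast
    linear_combination ((a + b).factorial : ℝ) * key a b + (a + 1 / 2) * ih
  | zero =>
    induction b with
    | zero => simp [gammaHalf]
    | succ b ih =>
      have h1 := integral_cos_sin_parts 0 b
      have h2 := integral_cos_sin_add 0 b
      have h3 : gammaHalf (b + 1) = (b + 1 / 2) * gammaHalf b := by rw [gammaHalf]
      rw [show 0 + (b + 1) = (0 + b) + 1 by ring, Nat.factorial_succ, h3]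
      push_cast at *
      linear_combination (b + 1 / 2) * ih + (0 + b).factorial * (-(1 / 2) * h1 + (b + 1 / 2) * h2)

lemma gammaHalf_mul_le (n i j : ℕ) :
    gammaHalf (n + i) * gammaHalf (n + j) ≤ gammaHalf n * gammaHalf (n + (i + j)) := by
  induction i with
  | zero => simp
  | succ i ih =>
    rw [← add_assoc, gammaHalf, show n + (i + 1 + j) = n + (i + j) + 1 by ring, gammaHalf]
    push_cast
    have h1 := gammaHalf_pos n
    have h2 := gammaHalf_pos (n + (i + j))
    calc ((n : ℝ) + i + 1 / 2) * gammaHalf (n + i) * gammaHalf (n + j)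
        = (n + i + 1 / 2) * (gammaHalf (n + i) * gammaHalf (n + j)) := by ring
      _ ≤ (n + i + 1 / 2) * (gammaHalf n * gammaHalf (n + (i + j))) := by gcongr
      _ ≤ (n + (i + j) + 1 / 2) * (gammaHalf n * gammaHalf (n + (i + j))) := by
          gcongr; linarith
      _ = _ := by ring

lemma factorial_le_gammaHalf (n : ℕ) : (n.factorial : ℝ) ≤ 2 * gammaHalf (n + 1) := by
  induction n with
  | zero => simp [gammaHalf]
  | succ n ih =>
    rw [Nat.factorial_succ, gammaHalf]
    push_cast
    have := gammaHalf_pos (n + 1)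
    nlinarith

lemma tendsto_pow_div_gammaHalf (R : ℝ) (hR : 0 ≤ R) :
    Tendsto (fun n : ℕ => R ^ n / gammaHalf (n + 1)) atTop (𝓝 0) := by
  have h := (FloorSemiring.tendsto_pow_div_factorial_atTop R).const_mul 2
  rw [mul_zero] at h
  refine squeeze_zero (fun n => div_nonneg (by positivity) (gammaHalf_pos _).le) (fun n => ?_) h
  have := gammaHalf_pos (n + 1)
  have h2 := factorial_le_gammaHalf n
  rw [mul_div_assoc', div_le_div_iff₀ this (by positivity)]
  nlinarith [pow_nonneg hR n]

lemma limits_eq_zero_of_convolution_bound (u v : ℕ → ℂ) (c d : ℂ) (hu : Tendsto u atTop (𝓝 c))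
    (hv : Tendsto v atTop (𝓝 d)) (hu0 : u 0 ≠ 0) (hv0 : v 0 ≠ 0) (C R : ℝ) (hR : 0 ≤ R)
    (hD : ∀ k, ‖∑ a ∈ Finset.range (k + 1), (-1) ^ a * u a * v (k - a) *
      ((gammaHalf (a + 1) * gammaHalf (k - a + 1) : ℝ) : ℂ)‖ ≤ C * R ^ k) : c = 0 ∧ d = 0 := by
  obtain ⟨M, hM⟩ := hu.norm.bddAbove_range
  obtain ⟨N, hN⟩ := hv.norm.bddAbove_range
  replace hM : ∀ n, ‖u n‖ ≤ M := fun n => hM ⟨n, rfl⟩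
  replace hN : ∀ n, ‖v n‖ ≤ N := fun n => hN ⟨n, rfl⟩
  have hM0 : 0 ≤ M := (norm_nonneg _).trans (hM 0)
  have hN0 : 0 ≤ N := (norm_nonneg _).trans (hN 0)
  set D : ℕ → ℂ := fun k => ∑ a ∈ Finset.range (k + 1), (-1) ^ a * u a * v (k - a) *
      ((gammaHalf (a + 1) * gammaHalf (k - a + 1) : ℝ) : ℂ) with hDdef
  have g1 : gammaHalf 1 = 1 / 2 := by norm_num [gammaHalf]
  set t : ℕ → ℕ → ℂ := fun k a => (-1) ^ a * u a * v (k - a) *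
      ((gammaHalf (a + 1) * gammaHalf (k - a + 1) : ℝ) : ℂ) with ht
  have htb : ∀ k a, ‖t k a‖ ≤ M * N * (gammaHalf (a + 1) * gammaHalf (k - a + 1)) := by
    intro k a
    have := gammaHalf_pos (a + 1)
    have := gammaHalf_pos (k - a + 1)
    simp only [ht, norm_mul, norm_pow, norm_neg, norm_one, one_pow, one_mul, norm_real]
    rw [Real.norm_of_nonneg (by positivity), Real.norm_of_nonneg (by positivity)]
    gcongr
    · exact hM _
    · exact hN _
  have main : ∀ n : ℕ, ‖(-1) ^ (n + 4) * v 0 * u (n + 4) + u 0 * v (n + 4)‖ ≤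
      2 * (C * (R ^ (n + 4) / gammaHalf (n + 4 + 1)) +
        (2 * M * N * gammaHalf 2 * (1 / (n + 4 + 1 / 2)) +
          M * N * gammaHalf 3 * (1 / (n + 3 + 1 / 2)))) := by
    intro n
    have e1 : D (n + 4) = t (n + 4) 0 + t (n + 4) (n + 4) + (t (n + 4) 1 + t (n + 4) (n + 3)
        + ∑ i ∈ Finset.range (n + 1), t (n + 4) (i + 2)) := by
      simp only [hDdef]
      rw [Finset.sum_range_succ, Finset.sum_range_succ, Finset.sum_range_succ',
        Finset.sum_range_succ']
      simp only [ht]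
      ring
    have g4 : gammaHalf (n + 5) = (n + 4 + 1 / 2) * gammaHalf (n + 4) := by
      rw [gammaHalf]; push_cast; ring
    have g3 : gammaHalf (n + 4) = (n + 3 + 1 / 2) * gammaHalf (n + 3) := by
      rw [gammaHalf]; push_cast; ring
    have p3 := gammaHalf_pos (n + 3)
    have p4 := gammaHalf_pos (n + 4)
    have p5 := gammaHalf_pos (n + 5)
    have q2 := gammaHalf_pos 2
    have q3 := gammaHalf_pos 3
    have e2 : t (n + 4) 0 + t (n + 4) (n + 4) = ((gammaHalf (n + 5) / 2 : ℝ) : ℂ) *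
        ((-1) ^ (n + 4) * v 0 * u (n + 4) + u 0 * v (n + 4)) := by
      simp only [ht, Nat.sub_self, Nat.sub_zero, zero_add, g1]
      push_cast
      ring
    have b1 : ‖t (n + 4) 1‖ ≤ M * N * (gammaHalf 2 * gammaHalf (n + 4)) := htb (n + 4) 1
    have b2 : ‖t (n + 4) (n + 3)‖ ≤ M * N * (gammaHalf (n + 4) * gammaHalf 2) := by
      have := htb (n + 4) (n + 3)
      rwa [show n + 4 - (n + 3) + 1 = 2 by omega] at this
    have b3 : ‖∑ i ∈ Finset.range (n + 1), t (n + 4) (i + 2)‖ ≤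
        (n + 1) * (M * N * (gammaHalf 3 * gammaHalf (n + 3))) := by
      refine (norm_sum_le_of_le _ (f := fun i => t (n + 4) (i + 2))
        (n := fun _ => M * N * (gammaHalf 3 * gammaHalf (n + 3))) fun i hi => ?_).trans
        (by simp)
      refine (htb _ _).trans ?_
      have hi' : i ≤ n := by simpa [Nat.lt_succ_iff] using hi
      have := gammaHalf_mul_le 3 i (n - i)
      rw [show 3 + i = i + 2 + 1 by ring, show 3 + (n - i) = n + 4 - (i + 2) + 1 by omega,
        show 3 + (i + (n - i)) = n + 3 by omega] at this
      gcongr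
    have b0 : ‖t (n + 4) 0 + t (n + 4) (n + 4)‖ ≤ C * R ^ (n + 4) +
        (M * N * (gammaHalf 2 * gammaHalf (n + 4)) + M * N * (gammaHalf (n + 4) * gammaHalf 2) +
          (n + 1) * (M * N * (gammaHalf 3 * gammaHalf (n + 3)))) := by
      rw [eq_sub_of_add_eq e1.symm]
      refine (norm_sub_le _ _).trans (add_le_add (hD _) ?_)
      exact (norm_add_le _ _).trans (add_le_add ((norm_add_le _ _).trans (add_le_add b1 b2)) b3)
    rw [e2, norm_mul, norm_real, Real.norm_of_nonneg (by positivity)] at b0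
    have b4 : (n + 1) * (M * N * (gammaHalf 3 * gammaHalf (n + 3))) ≤
        M * N * gammaHalf 3 * gammaHalf (n + 4) := by
      rw [g3]
      have : 0 ≤ M * N * gammaHalf 3 * gammaHalf (n + 3) := by positivity
      nlinarith
    have e3 : 1 / ((n : ℝ) + 4 + 1 / 2) = gammaHalf (n + 4) / gammaHalf (n + 5) := by
      rw [g4]; field_simp
    have b5 : gammaHalf (n + 4) / gammaHalf (n + 5) ≤ 1 / ((n : ℝ) + 3 + 1 / 2) := by
      rw [← e3]; gcongr; norm_num
    have b6 : M * N * gammaHalf 3 * (gammaHalf (n + 4) / gammaHalf (n + 5)) ≤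
        M * N * gammaHalf 3 * (1 / ((n : ℝ) + 3 + 1 / 2)) := by gcongr
    rw [e3]
    refine le_trans ?_ (mul_le_mul_of_nonneg_left (add_le_add le_rfl (add_le_add le_rfl b6))
      (by norm_num))
    rw [show n + 4 + 1 = n + 5 by ring]
    have : 2 * (C * (R ^ (n + 4) / gammaHalf (n + 5)) +
        (2 * M * N * gammaHalf 2 * (gammaHalf (n + 4) / gammaHalf (n + 5)) +
          M * N * gammaHalf 3 * (gammaHalf (n + 4) / gammaHalf (n + 5)))) =
        (C * R ^ (n + 4) + (2 * M * N * gammaHalf 2 * gammaHalf (n + 4) +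
          M * N * gammaHalf 3 * gammaHalf (n + 4))) / (gammaHalf (n + 5) / 2) := by
      field_simp
    rw [this, le_div_iff₀ (by positivity)]
    linarith
  have lim : Tendsto (fun k : ℕ => (-1) ^ k * v 0 * u k + u 0 * v k) atTop (𝓝 0) := by
    rw [← tendsto_add_atTop_iff_nat 4]
    refine squeeze_zero_norm main ?_
    have l1 := (tendsto_add_atTop_iff_nat 4).mpr (tendsto_pow_div_gammaHalf R hR)
    have l2 : ∀ x : ℝ, Tendsto (fun n : ℕ => 1 / ((n : ℝ) + x + 1 / 2)) atTop (𝓝 0) := by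
      intro x
      simp only [one_div]
      exact tendsto_inv_atTop_zero.comp (tendsto_atTop_add_const_right _ _
        (tendsto_atTop_add_const_right _ _ tendsto_natCast_atTop_atTop))
    simpa using ((l1.const_mul C).add (((l2 4).const_mul (2 * M * N * gammaHalf 2)).add
      ((l2 3).const_mul (M * N * gammaHalf 3)))).const_mul 2
  have tE : Tendsto (fun n : ℕ => 2 * n) atTop atTop :=
    tendsto_atTop_mono (fun n => by simp only [id]; omega) tendsto_id
  have tO : Tendsto (fun n : ℕ => 2 * n + 1) atTop atTop :=
    tendsto_atTop_mono (fun n => by simp only [id]; omega) tendsto_id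
  have lE := lim.comp tE
  have lO := lim.comp tO
  have hE := tendsto_nhds_unique lE (b := v 0 * c + u 0 * d) (by
      simpa [Function.comp_def] using ((hu.comp tE).const_mul (v 0)).add ((hv.comp tE).const_mul (u 0)))
  have hO := tendsto_nhds_unique lO (b := -(v 0 * c) + u 0 * d) (by
      simpa [Function.comp_def, pow_succ] using
        ((hu.comp tO).const_mul (v 0)).neg.add ((hv.comp tO).const_mul (u 0)))
  constructor
  · have : v 0 * c = 0 := by linear_combination (hO - hE) / 2
    exact (mul_eq_zero.mp this).resolve_left hv0
  · have : u 0 * d = 0 := by linear_combination -(hO + hE) / 2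
    exact (mul_eq_zero.mp this).resolve_left hu0

lemma exists_hasSum_of_even (L : ℂ → ℂ) (R : ℝ) (hL : DifferentiableOn ℂ L (ball 0 R))
    (heven : ∀ y ∈ ball (0 : ℂ) R, L (-y) = L y) :
    ∃ l : ℕ → ℂ, ∀ y ∈ ball (0 : ℂ) R, HasSum (fun n => l n * (y ^ 2) ^ n) (L y) := by
  refine ⟨fun n => ((2 * n).factorial : ℂ)⁻¹ * iteratedDeriv (2 * n) L 0, fun y hy => ?_⟩
  have h1 := Complex.hasSum_taylorSeries_on_ball hL hy
  have h2 := Complex.hasSum_taylorSeries_on_ball hL (z := -y) (by simpa using hy)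
  rw [heven y hy] at h2
  have h3 := (h1.add h2).mul_left (1 / 2)
  rw [show 1 / 2 * (L y + L y) = L y by ring] at h3
  have hinj : Function.Injective (fun n : ℕ => 2 * n) := fun a b h => by simpa using h
  rw [← hinj.hasSum_iff] at h3
  · refine HasSum.congr_fun h3 fun n => ?_
    simp [pow_mul]
    ring
  · intro n hn
    have : Odd n := by
      rw [← Nat.not_even_iff_odd]
      exact fun ⟨k, hk⟩ => hn ⟨k, by simp only; omega⟩
    simp [this.neg_pow]

lemma differentiable_dslope {f : ℂ → ℂ} (hf : Differentiable ℂ f) (a : ℂ) :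
    Differentiable ℂ (dslope f a) := by
  rw [← differentiableOn_univ] at hf ⊢
  exact (Complex.differentiableOn_dslope Filter.univ_mem).mpr hf

lemma exists_eq_mul_of_odd (f : ℂ → ℂ) (hf : Differentiable ℂ f) (hodd : ∀ y, f (-y) = -f y) :
    ∃ g : ℂ → ℂ, Differentiable ℂ g ∧ (∀ y, f y = y * g y) ∧ (∀ y, g (-y) = g y) ∧
      g 0 = deriv f 0 := by
  have h0 : f 0 = 0 := by
    have := hodd 0
    simp only [neg_zero] at this
    exact self_eq_neg.mp this
  have key : ∀ y, f y = y * dslope f 0 y := fun y => by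
    simpa [h0] using (sub_smul_dslope f 0 y).symm
  refine ⟨dslope f 0, differentiable_dslope hf 0, key, fun y => ?_, dslope_same f 0⟩
  rcases eq_or_ne y 0 with rfl | hy
  · simp
  · have h1 := key (-y)
    rw [hodd, key y] at h1
    exact mul_left_cancel₀ hy (by linear_combination h1)

lemma sinh_eq_zero_iff (y : ℂ) : Complex.sinh y = 0 ↔ ∃ k : ℤ, y = k * (π * I) := by
  have h : Complex.sinh y = 0 ↔ Complex.sin (y * I) = 0 := by
    rw [Complex.sin_mul_I]; simp
  rw [h, Complex.sin_eq_zero_iff]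
  constructor
  · rintro ⟨k, hk⟩
    refine ⟨-k, ?_⟩
    push_cast
    linear_combination (-I) * hk + y * I_mul_I
  · rintro ⟨k, hk⟩
    refine ⟨-k, ?_⟩
    push_cast
    linear_combination I * hk + k * π * I_mul_I

lemma exists_sinh_factor : ∃ E : ℂ → ℂ, Differentiable ℂ E ∧
    (∀ y, Complex.sinh y = y * (y ^ 2 + π ^ 2) * E y) ∧ (∀ y, E (-y) = E y) ∧
    ∀ y ∈ ball (0 : ℂ) (2 * π), E y ≠ 0 := by
  set c : ℂ := π * I with hc
  have hcs : c ^ 2 = -π ^ 2 := by rw [hc, mul_pow, I_sq]; ring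
  have hpi : (π : ℂ) ≠ 0 := by exact_mod_cast Real.pi_ne_zero
  have hc0 : c ≠ 0 := mul_ne_zero hpi I_ne_zero
  set D1 := dslope Complex.sinh 0
  set D2 := dslope D1 c
  set E := dslope D2 (-c)
  have hD1 : Differentiable ℂ D1 := differentiable_dslope Complex.differentiable_sinh 0
  have hD2 : Differentiable ℂ D2 := differentiable_dslope hD1 c
  have hE : Differentiable ℂ E := differentiable_dslope hD2 (-c)
  have e1 : ∀ y, Complex.sinh y = y * D1 y := fun y => by
    simpa using (sub_smul_dslope Complex.sinh 0 y).symm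
  have sc : Complex.sinh c = 0 := (sinh_eq_zero_iff c).mpr ⟨1, by simp [hc]⟩
  have d1c : D1 c = 0 := by
    have := e1 c
    rw [sc] at this
    exact (mul_eq_zero.mp this.symm).resolve_left hc0
  have e2 : ∀ y, D1 y = (y - c) * D2 y := fun y => by
    simpa [d1c] using (sub_smul_dslope D1 c y).symm
  have d2c : D2 (-c) = 0 := by
    have := e1 (-c)
    rw [e2, Complex.sinh_neg, sc] at this
    have h : (-c * (-c - c)) * D2 (-c) = 0 := by linear_combination -this
    refine (mul_eq_zero.mp h).resolve_left ?_
    rw [show -c * (-c - c) = 2 * c ^ 2 by ring]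
    simp [hc0]
  have e3 : ∀ y, D2 y = (y + c) * E y := fun y => by
    simpa [d2c] using (sub_smul_dslope D2 (-c) y).symm
  have e : ∀ y, Complex.sinh y = y * (y ^ 2 + π ^ 2) * E y := fun y => by
    rw [e1, e2, e3]
    linear_combination (-y * E y) * hcs
  have der : ∀ y, Complex.cosh y = (3 * y ^ 2 + π ^ 2) * E y
      + y * (y ^ 2 + π ^ 2) * deriv E y := by
    intro y
    have h1 := Complex.hasDerivAt_sinh y
    have h2 : HasDerivAt Complex.sinh
        ((1 * (y ^ 2 + π ^ 2) + y * (2 * y)) * E y + y * (y ^ 2 + π ^ 2) * deriv E y) y := by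
      rw [funext e]
      have h3 : HasDerivAt (fun y : ℂ => y ^ 2 + (π : ℂ) ^ 2) (2 * y) y := by
        simpa using (hasDerivAt_pow 2 y).add_const ((π : ℂ) ^ 2)
      exact ((hasDerivAt_id y).mul h3).mul (hE y).hasDerivAt
    rw [h1.unique h2]
    ring
  refine ⟨E, hE, e, fun y => ?_, fun y hy h0 => ?_⟩
  · by_cases h : y * (y ^ 2 + π ^ 2) = 0
    · have h3 : 3 * y ^ 2 + (π : ℂ) ^ 2 ≠ 0 := by
        rcases mul_eq_zero.mp h with h | h
        · simp [h, hpi]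
        · rw [show 3 * y ^ 2 + (π : ℂ) ^ 2 = -2 * π ^ 2 by linear_combination 3 * h]
          simp [hpi]
      have h1 := der y
      have h2 := der (-y)
      rw [Complex.cosh_neg, h1] at h2
      refine mul_left_cancel₀ h3 ?_
      linear_combination -h2 + (deriv E y + deriv E (-y)) * h
    · have h1 := e (-y)
      rw [Complex.sinh_neg, e y] at h1
      exact mul_left_cancel₀ h (by linear_combination h1)
  · have hs : Complex.sinh y = 0 := by rw [e, h0, mul_zero]
    obtain ⟨k, hk⟩ := (sinh_eq_zero_iff y).mp hs
    have hk2 : |k| < 2 := by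
      rw [mem_ball_zero_iff, hk, norm_mul, norm_mul, norm_I, mul_one, norm_real,
        Real.norm_of_nonneg Real.pi_pos.le, norm_intCast] at hy
      have := lt_of_mul_lt_mul_right hy Real.pi_pos.le
      exact_mod_cast this
    have hroot : y * (y ^ 2 + π ^ 2) = 0 := by
      have : k = -1 ∨ k = 0 ∨ k = 1 := by
        rw [abs_lt] at hk2; omega
      rcases this with rfl | rfl | rfl <;> rw [hk] <;> push_cast
      · linear_combination (-π * I) * π ^ 2 * I_sq
      · ring
      · linear_combination (π * I) * π ^ 2 * I_sq
    have h1 := der y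
    rw [h0, hroot] at h1
    have h2 := Complex.cosh_sq y
    rw [hs, h1] at h2
    simp at h2

/-- The function `Fmpz` in the rescaled variable `y = √(mp) x`, with `ζ = 2z + 1`. -/
noncomputable def sinhQuot (m p : ℕ) (ζ y : ℂ) : ℂ :=
  ((if ζ = 0 then y else Complex.sinh (ζ * y) / ζ) * Complex.sinh (y / p) * Complex.sinh (y / m))
    / Complex.sinh y

lemma sinhQuot_analytic_factor (m p : ℕ) (hm : 2 ≤ m) (hp : 2 ≤ p) (ζ : ℂ) :
    ∃ L : ℂ → ℂ, DifferentiableOn ℂ L (ball 0 (2 * π)) ∧ (∀ y ∈ ball (0 : ℂ) (2 * π), L (-y) = L y) ∧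
      L 0 ≠ 0 ∧ ((¬ ∃ n : ℤ, n ≠ 0 ∧ ζ = n) → L (π * I) ≠ 0) ∧
      ∀ y ∈ ball (0 : ℂ) π, sinhQuot m p ζ y = y ^ 2 * (L y / (y ^ 2 + π ^ 2)) := by
  have hpi : (π : ℂ) ≠ 0 := by exact_mod_cast Real.pi_ne_zero
  obtain ⟨E, hE, eE, evE, Ene⟩ := exists_sinh_factor
  set S : ℂ → ℂ := fun y => if ζ = 0 then y else Complex.sinh (ζ * y) / ζ with hS
  have hSd : ∀ y, HasDerivAt S (if ζ = 0 then 1 else Complex.cosh (ζ * y)) y := by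
    intro y
    by_cases hζ : ζ = 0
    · simp only [hS, hζ, if_true]
      exact hasDerivAt_id' y
    · simp only [hS, hζ, if_false]
      have := (((hasDerivAt_id y).const_mul ζ).csinh).div_const ζ
      simpa [hζ] using this
  have hsd : ∀ (q : ℕ) y, HasDerivAt (fun y : ℂ => Complex.sinh (y / q))
      (Complex.cosh (y / q) * (1 / q)) y := fun q y => ((hasDerivAt_id y).div_const (q : ℂ)).csinh
  obtain ⟨S1, dS, eS, evS, S0⟩ := exists_eq_mul_of_odd S (fun y => (hSd y).differentiableAt)
    (fun y => by simp only [hS]; split_ifs <;> simp [neg_div])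
  obtain ⟨A, dA, eA, evA, A0⟩ := exists_eq_mul_of_odd _ (fun y => (hsd p y).differentiableAt)
    (fun y => by simp [neg_div])
  obtain ⟨B, dB, eB, evB, B0⟩ := exists_eq_mul_of_odd _ (fun y => (hsd m y).differentiableAt)
    (fun y => by simp [neg_div])
  rw [(hSd 0).deriv] at S0
  rw [(hsd p 0).deriv] at A0
  rw [(hsd m 0).deriv] at B0
  have hm0 : (m : ℂ) ≠ 0 := by norm_cast; omega
  have hp0 : (p : ℂ) ≠ 0 := by norm_cast; omega
  have hsinh : ∀ q : ℕ, 2 ≤ q → Complex.sinh (π * I / q) ≠ 0 := by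
    intro q hq h
    have hq0 : (q : ℂ) ≠ 0 := by norm_cast; omega
    obtain ⟨k, hk⟩ := (sinh_eq_zero_iff _).mp h
    have hk' : ((k * q : ℤ) : ℂ) = ((1 : ℤ) : ℂ) := by
      rw [div_eq_iff hq0] at hk
      have h2 : (π * I : ℂ) ≠ 0 := mul_ne_zero hpi I_ne_zero
      refine mul_right_cancel₀ h2 ?_
      push_cast
      linear_combination -hk
    have hk2 : k * (q : ℤ) = 1 := by exact_mod_cast hk'
    have := Int.le_of_dvd one_pos (Dvd.intro_left k hk2)
    omega
  have hmem : (π * I : ℂ) ∈ ball (0 : ℂ) (2 * π) := by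
    simp [abs_of_pos Real.pi_pos]
    linarith [Real.pi_pos]
  have hmem0 : (0 : ℂ) ∈ ball (0 : ℂ) (2 * π) := by simp [Real.pi_pos]
  refine ⟨fun y => S1 y * A y * B y / E y, ?_, fun y _ => by simp only [evS, evA, evB, evE], ?_,
    fun hζ => ?_, fun y hy => ?_⟩
  · exact ((dS.mul dA).mul dB).differentiableOn.div hE.differentiableOn Ene
  · have : S1 0 = 1 := by rw [S0]; simp
    beta_reduce
    rw [this, A0, B0]
    simp [hm0, hp0, Ene 0 hmem0]
  · have hc : (π * I : ℂ) ≠ 0 := mul_ne_zero hpi I_ne_zero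
    refine div_ne_zero (mul_ne_zero (mul_ne_zero ?_ ?_) ?_) (Ene _ hmem)
    · refine right_ne_zero_of_mul (a := (π * I : ℂ)) ?_
      rw [← eS]
      simp only [hS]
      split_ifs with h0
      · exact hc
      · refine div_ne_zero (fun h => hζ ?_) h0
        obtain ⟨k, hk⟩ := (sinh_eq_zero_iff _).mp h
        have := mul_right_cancel₀ hc hk
        exact ⟨k, fun hk0 => h0 (by rw [this, hk0]; simp), this⟩
    · refine right_ne_zero_of_mul (a := (π * I : ℂ)) ?_
      rw [← eA]
      exact hsinh p hp
    · refine right_ne_zero_of_mul (a := (π * I : ℂ)) ?_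
      rw [← eB]
      exact hsinh m hm
  · have hE0 : E y ≠ 0 := Ene y (ball_subset_ball (by linarith [Real.pi_pos]) hy)
    rw [sinhQuot, show (if ζ = 0 then y else Complex.sinh (ζ * y) / ζ) = S y from rfl, eS]
    have e1 := eA y
    have e2 := eB y
    rw [e1, e2, eE]
    rcases eq_or_ne y 0 with rfl | hy0
    · simp
    have hq : y ^ 2 + (π : ℂ) ^ 2 ≠ 0 := by
      intro h
      have h2 : ‖y‖ ^ 2 = π ^ 2 := by
        rw [← norm_pow, eq_neg_of_add_eq_zero_left h, norm_neg, norm_pow, norm_real,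
          Real.norm_of_nonneg Real.pi_pos.le]
      rw [mem_ball_zero_iff] at hy
      have := pow_lt_pow_left₀ hy (norm_nonneg _) two_ne_zero
      linarith
    field_simp

lemma sinhQuot_expansion (m p : ℕ) (hm : 2 ≤ m) (hp : 2 ≤ p) (ζ : ℂ) :
    ∃ (u : ℕ → ℂ) (c : ℂ), u 0 ≠ 0 ∧ Tendsto u atTop (𝓝 c) ∧
      ((¬ ∃ n : ℤ, n ≠ 0 ∧ ζ = n) → c ≠ 0) ∧
      ∀ y ∈ ball (0 : ℂ) π, HasSum (fun n => y ^ 2 * (u n * (-(y ^ 2) / π ^ 2) ^ n))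
        (sinhQuot m p ζ y) := by
  have hpi : (π : ℂ) ≠ 0 := by exact_mod_cast Real.pi_ne_zero
  obtain ⟨L, dL, evL, L0, Lpi, eL⟩ := sinhQuot_analytic_factor m p hm hp ζ
  obtain ⟨l, hl⟩ := exists_hasSum_of_even L _ dL evL
  have hmem : (π * I : ℂ) ∈ ball (0 : ℂ) (2 * π) := by
    simp [abs_of_pos Real.pi_pos]
    linarith [Real.pi_pos]
  have hlpi := hl _ hmem
  refine ⟨fun n => (∑ k ∈ Finset.range (n + 1), l k * ((π * I) ^ 2) ^ k) / π ^ 2,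
    L (π * I) / π ^ 2, ?_, ?_, fun h => div_ne_zero (Lpi h) (pow_ne_zero 2 hpi), fun y hy => ?_⟩
  · have h0 := (hl 0 (by simp [Real.pi_pos])).unique
      (hasSum_single 0 (fun n hn => by simp [hn]))
    simp only [zero_add, Finset.sum_range_one, pow_zero, mul_one] at h0 ⊢
    rw [← h0]
    exact div_ne_zero L0 (pow_ne_zero 2 hpi)
  · exact ((tendsto_add_atTop_iff_nat 1).mpr hlpi.tendsto_sum_nat).div_const _
  · rw [eL y hy]
    refine HasSum.mul_left _ ?_
    have hy2 := hl y (ball_subset_ball (by linarith [Real.pi_pos]) hy)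
    have hr : ‖-(y ^ 2) / (π : ℂ) ^ 2‖ < 1 := by
      rw [norm_div, norm_neg, norm_pow, norm_pow, norm_real, Real.norm_of_nonneg Real.pi_pos.le,
        div_lt_one (by positivity)]
      rw [mem_ball_zero_iff] at hy
      exact pow_lt_pow_left₀ hy (norm_nonneg _) two_ne_zero
    have hg := hasSum_geometric_of_norm_lt_one hr
    have hprod := hasSum_sum_range_mul_of_summable_norm hy2.summable.norm hg.summable.norm
    rw [hy2.tsum_eq, hg.tsum_eq] at hprod
    have hprod := hprod.div_const ((π : ℂ) ^ 2)
    have e1 : L y / (y ^ 2 + π ^ 2) = L y * (1 - -(y ^ 2) / (π : ℂ) ^ 2)⁻¹ / π ^ 2 := by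
      rw [show 1 - -(y ^ 2) / (π : ℂ) ^ 2 = (y ^ 2 + π ^ 2) / π ^ 2 by field_simp; ring, inv_div]
      field_simp
    rw [e1]
    refine HasSum.congr_fun hprod fun n => ?_
    rw [div_mul_eq_mul_div, Finset.sum_mul]
    congr 1
    refine Finset.sum_congr rfl fun k hk => ?_
    have hk' : k ≤ n := by simpa [Nat.lt_succ_iff] using hk
    obtain ⟨j, rfl⟩ := Nat.exists_eq_add_of_le hk'
    rw [Nat.add_sub_cancel_left, pow_add, mul_pow (π : ℂ) I, I_sq, ← mul_assoc, mul_assoc (l k),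
      ← mul_pow, show (π : ℂ) ^ 2 * -1 * (-(y ^ 2) / π ^ 2) = y ^ 2 by field_simp]

lemma hasSum_integral_mul_of_cos_sin (f g : ℕ → ℂ) (A B : ℝ → ℂ) (sumf : Summable fun n => ‖f n‖)
    (sumg : Summable fun n => ‖g n‖)
    (hF : ∀ θ : ℝ, HasSum (fun n => f n * (Real.cos θ : ℂ) ^ (2 * (n + 1))) (A θ))
    (hG : ∀ θ : ℝ, HasSum (fun n => g n * (Real.sin θ : ℂ) ^ (2 * (n + 1))) (B θ)) :
    HasSum (fun k : ℕ => ∑ a ∈ Finset.range (k + 1), f a * g (k - a) *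
        ((∫ θ in (0:ℝ)..(2 * π),
          Real.cos θ ^ (2 * (a + 1)) * Real.sin θ ^ (2 * (k - a + 1)) : ℝ) : ℂ))
      (∫ θ in (0:ℝ)..(2 * π), A θ * B θ) := by
  have cosle : ∀ (θ : ℝ) n, ‖(Real.cos θ : ℂ) ^ n‖ ≤ 1 := fun θ n => by
    rw [norm_pow, norm_real]
    exact pow_le_one₀ (norm_nonneg _) (Real.abs_cos_le_one θ)
  have sinle : ∀ (θ : ℝ) n, ‖(Real.sin θ : ℂ) ^ n‖ ≤ 1 := fun θ n => by
    rw [norm_pow, norm_real]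
    exact pow_le_one₀ (norm_nonneg _) (Real.abs_sin_le_one θ)
  set F : ℕ → ℝ → ℂ := fun k θ => ∑ a ∈ Finset.range (k + 1),
    (f a * (Real.cos θ : ℂ) ^ (2 * (a + 1))) *
      (g (k - a) * (Real.sin θ : ℂ) ^ (2 * (k - a + 1))) with hFdef
  have hFc : ∀ k, Continuous (F k) := fun k => by
    simp only [hFdef]
    fun_prop
  have hFb : ∀ k θ, ‖F k θ‖ ≤ ∑ a ∈ Finset.range (k + 1), ‖f a‖ * ‖g (k - a)‖ := fun k θ => by
    refine norm_sum_le_of_le _ fun a _ => ?_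
    rw [norm_mul, norm_mul (f a), norm_mul (g _)]
    exact mul_le_mul (mul_le_of_le_one_right (norm_nonneg _) (cosle _ _))
      (mul_le_of_le_one_right (norm_nonneg _) (sinle _ _)) (by positivity) (norm_nonneg _)
  have hbs : Summable fun k => ∑ a ∈ Finset.range (k + 1), ‖f a‖ * ‖g (k - a)‖ := by
    have h1 : Summable fun n => ‖(‖f n‖)‖ := by simpa only [norm_norm] using sumf
    have h2 : Summable fun n => ‖(‖g n‖)‖ := by simpa only [norm_norm] using sumg
    exact (summable_norm_sum_mul_range_of_summable_norm h1 h2).of_norm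
  have hlim : ∀ θ : ℝ, HasSum (fun k => F k θ)
      (A θ * B θ) :=
    fun θ => by
      have := hasSum_sum_range_mul_of_summable_norm (hF θ).summable.norm (hG θ).summable.norm
      rwa [(hF θ).tsum_eq, (hG θ).tsum_eq] at this
  have key := intervalIntegral.hasSum_integral_of_dominated_convergence (μ := volume)
    (a := 0) (b := 2 * π) (fun k _ => ∑ a ∈ Finset.range (k + 1), ‖f a‖ * ‖g (k - a)‖)
    (fun k => (hFc k).aestronglyMeasurable) (fun k => ae_of_all _ fun θ _ => hFb k θ)
    (ae_of_all _ fun θ _ => hbs) intervalIntegrable_const (ae_of_all _ fun θ _ => hlim θ)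
  refine HasSum.congr_fun key fun k => ?_
  simp only [hFdef]
  rw [intervalIntegral.integral_finsetSum
    fun a _ => Continuous.intervalIntegrable (by fun_prop) _ _]
  refine Finset.sum_congr rfl fun a _ => ?_
  rw [← intervalIntegral.integral_ofReal, ← intervalIntegral.integral_const_mul]
  refine intervalIntegral.integral_congr fun θ _ => ?_
  push_cast
  ring

lemma hasSum_integral_sinhQuot (m p : ℕ) (ζ ξ r : ℂ) (u v : ℕ → ℂ) (hr : r ∈ ball (0 : ℂ) π)
    (hu : ∀ y ∈ ball (0 : ℂ) π, HasSum (fun n => y ^ 2 * (u n * (-(y ^ 2) / π ^ 2) ^ n))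
      (sinhQuot m p ζ y))
    (hv : ∀ y ∈ ball (0 : ℂ) π, HasSum (fun n => y ^ 2 * (v n * (-(y ^ 2) / π ^ 2) ^ n))
      (sinhQuot m p ξ y)) :
    HasSum (fun k : ℕ => -r ^ 4 * (r ^ 2 / π ^ 2) ^ k * ∑ a ∈ Finset.range (k + 1),
        (-1) ^ a * u a * v (k - a) * ((∫ θ in (0:ℝ)..(2 * π),
          Real.cos θ ^ (2 * (a + 1)) * Real.sin θ ^ (2 * (k - a + 1)) : ℝ) : ℂ))
      (∫ θ in (0:ℝ)..(2 * π),
        sinhQuot m p ζ (r * (Real.cos θ : ℂ)) * sinhQuot m p ξ (I * r * (Real.sin θ : ℂ))) := by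
  set f : ℕ → ℂ := fun n => r ^ 2 * (u n * (-(r ^ 2) / π ^ 2) ^ n) with hf
  set g : ℕ → ℂ := fun n => -r ^ 2 * (v n * (r ^ 2 / π ^ 2) ^ n) with hg
  have hIr : I * r ∈ ball (0 : ℂ) π := by simpa using hr
  have sumf : Summable fun n => ‖f n‖ := (hu r hr).summable.norm
  have sumg : Summable fun n => ‖g n‖ := by
    refine (hv _ hIr).summable.norm.congr fun n => ?_
    simp only [hg, mul_pow, I_sq]
    congr 2 <;> ring
  have hF : ∀ θ : ℝ, HasSum (fun n => f n * (Real.cos θ : ℂ) ^ (2 * (n + 1)))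
      (sinhQuot m p ζ (r * (Real.cos θ : ℂ))) := by
    intro θ
    have hmem : (r * (Real.cos θ : ℂ)) ∈ ball (0 : ℂ) π := by
      rw [mem_ball_zero_iff] at hr ⊢
      rw [norm_mul, norm_real, Real.norm_eq_abs]
      exact (mul_le_of_le_one_right (norm_nonneg _) (Real.abs_cos_le_one θ)).trans_lt hr
    refine HasSum.congr_fun (hu _ hmem) fun n => ?_
    simp only [hf]
    rw [mul_pow, show -(r ^ 2 * (Real.cos θ : ℂ) ^ 2) / (π : ℂ) ^ 2 =
        (-(r ^ 2) / π ^ 2) * (Real.cos θ : ℂ) ^ 2 by ring, mul_pow, mul_add, pow_add, pow_mul]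
    ring
  have hG : ∀ θ : ℝ, HasSum (fun n => g n * (Real.sin θ : ℂ) ^ (2 * (n + 1)))
      (sinhQuot m p ξ (I * r * (Real.sin θ : ℂ))) := by
    intro θ
    have hmem : (I * r * (Real.sin θ : ℂ)) ∈ ball (0 : ℂ) π := by
      rw [mem_ball_zero_iff] at hIr ⊢
      rw [norm_mul, norm_real, Real.norm_eq_abs]
      exact (mul_le_of_le_one_right (norm_nonneg _) (Real.abs_sin_le_one θ)).trans_lt hIr
    refine HasSum.congr_fun (hv _ hmem) fun n => ?_
    simp only [hg]
    rw [mul_pow, mul_pow, I_sq, show -(-1 * r ^ 2 * (Real.sin θ : ℂ) ^ 2) / (π : ℂ) ^ 2 =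
        (r ^ 2 / π ^ 2) * (Real.sin θ : ℂ) ^ 2 by ring, mul_pow, mul_add, pow_add, pow_mul]
    ring
  refine HasSum.congr_fun (hasSum_integral_mul_of_cos_sin f g _ _ sumf sumg hF hG) fun k => ?_
  rw [Finset.mul_sum]
  refine Finset.sum_congr rfl fun a ha => ?_
  have ha' : a ≤ k := by simpa [Nat.lt_succ_iff] using ha
  obtain ⟨b, rfl⟩ := Nat.exists_eq_add_of_le ha'
  simp only [hf, hg, Nat.add_sub_cancel_left]
  rw [neg_div, neg_pow (r ^ 2 / (π : ℂ) ^ 2), pow_add]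
  ring

lemma Fmpz_eq_sinhQuot (m p : ℕ) (hm : 2 ≤ m) (hp : 2 ≤ p) (z x : ℂ) :
    Fmpz m p z x = sinhQuot m p (2 * z + 1) ((Real.sqrt ((m : ℝ) * (p : ℝ)) : ℂ) * x) := by
  have hm0 : (0 : ℝ) < m := by positivity
  have hp0 : (0 : ℝ) < p := by positivity
  have e : ∀ a b : ℝ, 0 < a → 0 < b → Real.sqrt (a / b) = Real.sqrt (a * b) / b := by
    intro a b ha hb
    rw [eq_div_iff hb.ne', ← Real.sqrt_sq hb.le, ← Real.sqrt_mul (by positivity),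
      Real.sqrt_sq hb.le]
    congr 1
    field_simp
  rw [Fmpz, sinhQuot, e m p hm0 hp0, e p m hp0 hm0, mul_comm (p : ℝ) m]
  push_cast
  simp only [mul_assoc, div_mul_eq_mul_div]

/-- If `2z+1` is not a non-zero integer or `2w+1` is not a non-zero integer, then the
power series `Σ_{k≥2} P_{m,p,z,w}(k) k! h^{k+1}` (where `P` are the Taylor
coefficients at `0` of `G_{m,p,z,w}`) has radius of convergence `0`. -/
theorem stmt8 (m p : ℕ) (hm : 2 ≤ m) (hp : 2 ≤ p) (hcop : Nat.Coprime m p)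
    (z w : ℂ)
    (hzw : (¬ ∃ n : ℤ, n ≠ 0 ∧ 2 * z + 1 = (n : ℂ)) ∨ (¬ ∃ n : ℤ, n ≠ 0 ∧ 2 * w + 1 = (n : ℂ)))
    (P : ℕ → ℂ)
    (hP : ∀ᶠ x in 𝓝 (0 : ℂ),
      HasSum (fun k : ℕ => P (k + 2) * x ^ (2 * (k + 2)))
        (∫ θ in (0:ℝ)..(2 * Real.pi),
          Fmpz m p z (x * (Real.cos θ : ℂ)) * Fmpz m p w (Complex.I * x * (Real.sin θ : ℂ)))) :
    ∀ h : ℂ, h ≠ 0 →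
      ¬ Summable fun k : ℕ => ‖P (k + 2) * (((k + 2).factorial : ℕ) : ℂ) * h ^ (k + 3)‖ := by
  intro h hh hsum
  obtain ⟨u, c, u0, hu, hc, eu⟩ := sinhQuot_expansion m p hm hp (2 * z + 1)
  obtain ⟨v, d, v0, hv, hd, ev⟩ := sinhQuot_expansion m p hm hp (2 * w + 1)
  set s : ℝ := Real.sqrt ((m : ℝ) * (p : ℝ)) with hs
  have hs0 : 0 < s := Real.sqrt_pos.mpr (by positivity)
  set T : ℕ → ℂ := fun k => ∑ a ∈ Finset.range (k + 1),
      (-1) ^ a * u a * v (k - a) * ((∫ θ in (0:ℝ)..(2 * π),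
        Real.cos θ ^ (2 * (a + 1)) * Real.sin θ ^ (2 * (k - a + 1)) : ℝ) : ℂ) with hT
  set D : ℕ → ℂ := fun k => ∑ a ∈ Finset.range (k + 1), (-1) ^ a * u a * v (k - a) *
      ((gammaHalf (a + 1) * gammaHalf (k - a + 1) : ℝ) : ℂ) with hD
  have hTD : ∀ k, ((k + 2).factorial : ℂ) * T k = 2 * π * D k := by
    intro k
    simp only [hT, hD]
    rw [Finset.mul_sum, Finset.mul_sum]
    refine Finset.sum_congr rfl fun a ha => ?_
    have ha' : a ≤ k := by simpa [Nat.lt_succ_iff] using ha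
    obtain ⟨b, rfl⟩ := Nat.exists_eq_add_of_le ha'
    rw [Nat.add_sub_cancel_left]
    have := congrArg (fun t : ℝ => (t : ℂ)) (integral_cos_sin (a + 1) (b + 1))
    rw [show a + 1 + (b + 1) = a + b + 2 by ring] at this
    simp only [ofReal_mul, ofReal_natCast, ofReal_ofNat] at this ⊢
    linear_combination ((-1) ^ a * u a * v b) * this
  have hPT : ∀ k, P (k + 2) = -(s : ℂ) ^ 4 * ((s : ℂ) ^ 2 / π ^ 2) ^ k * T k := by
    intro k
    refine sub_eq_zero.mp (pow_series_unique
      (fun k => P (k + 2) - -(s : ℂ) ^ 4 * ((s : ℂ) ^ 2 / π ^ 2) ^ k * T k) ?_ k)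
    have hball : ∀ᶠ x in 𝓝 (0 : ℂ), (s : ℂ) * x ∈ ball (0 : ℂ) π := by
      have : Tendsto (fun x : ℂ => (s : ℂ) * x) (𝓝 0) (𝓝 0) := by
        simpa using (continuous_const_mul (s : ℂ)).tendsto 0
      exact this (ball_mem_nhds _ Real.pi_pos)
    filter_upwards [hP, hball] with x hx hxs
    have h2 := hasSum_integral_sinhQuot m p (2 * z + 1) (2 * w + 1) _ u v hxs eu ev
    simp only [Fmpz_eq_sinhQuot m p hm hp] at hx
    rw [← hs] at hx
    rw [show I * ((s : ℂ) * x) = s * (I * x) by ring] at h2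
    simp only [mul_assoc] at hx h2
    have h3 := hx.sub h2
    rw [sub_self] at h3
    refine HasSum.congr_fun h3 fun n => ?_
    simp only [hT, mul_assoc]
    rw [mul_pow, mul_pow, mul_div_right_comm, mul_pow, mul_add, pow_add, pow_mul x 2 n]
    ring
  obtain ⟨C, hC⟩ := hsum.tendsto_atTop_zero.bddAbove_range
  replace hC : ∀ k, ‖P (k + 2) * (((k + 2).factorial : ℕ) : ℂ) * h ^ (k + 3)‖ ≤ C :=
    fun k => hC ⟨k, rfl⟩
  have hh0 : 0 < ‖h‖ := norm_pos_iff.mpr hh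
  have hpi := Real.pi_pos
  obtain ⟨c0, d0⟩ := limits_eq_zero_of_convolution_bound u v c d hu hv u0 v0
    (C / (s ^ 4 * (2 * π) * ‖h‖ ^ 3)) (π ^ 2 / (s ^ 2 * ‖h‖)) (by positivity) (fun k => by
      change ‖D k‖ ≤ _
      have h1 := hC k
      rw [hPT, show -(s : ℂ) ^ 4 * ((s : ℂ) ^ 2 / π ^ 2) ^ k * T k *
        (((k + 2).factorial : ℕ) : ℂ) = -(s : ℂ) ^ 4 * ((s : ℂ) ^ 2 / π ^ 2) ^ k *
        (((k + 2).factorial : ℂ) * T k) by ring, hTD] at h1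
      simp only [norm_mul, norm_neg, norm_pow, norm_div, norm_real, Real.norm_of_nonneg hs0.le,
        Real.norm_of_nonneg hpi.le, norm_ofNat] at h1
      rw [div_pow, div_mul_div_comm, le_div_iff₀ (by positivity)]
      have h2 := mul_le_mul_of_nonneg_right h1 (pow_nonneg (sq_nonneg π) k)
      refine le_trans (le_of_eq ?_) h2
      rw [div_pow]
      field_simp
      ring)
  rcases hzw with h1 | h1
  · exact hc h1 c0
  · exact hd h1 d0
end

section
/- Let ρ > 0 and let f be an odd analytic function on the open disc B(0,ρ) ⊂ ℂ, with Taylor expansion f(y) = Σ_{n≥0} a_n y^{2n+1}. Then for every real x with 0 ≤ x < ρ², the integral ∫_0^x (x−ξ)^{−1/2} f(√ξ) dξ converges and equals Σ_{n≥0} a_n · (Γ(1/2) Γ(n+3/2) / Γ(n+2)) · x^{n+1}, the series converging absolutely. -/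
open Complex Filter MeasureTheory Metric Set Topology
open scoped Real Nat Classical

lemma intervalIntegrable_inv_sqrt_sub {x : ℝ} (hx : 0 ≤ x) :
    IntervalIntegrable (fun ξ : ℝ => ((Real.sqrt (x - ξ) : ℝ) : ℂ)⁻¹) volume 0 x := by
  have h : IntervalIntegrable (fun ξ : ℝ => (x - ξ) ^ (-(1 / 2) : ℝ)) volume 0 x := by
    have := (intervalIntegral.intervalIntegrable_rpow' (a := x) (b := 0)
      (r := -(1 / 2)) (by norm_num)).comp_sub_left x
    simpa using this
  have h' : IntervalIntegrable (fun ξ : ℝ => (Real.sqrt (x - ξ))⁻¹) volume 0 x := by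
    refine h.congr fun ξ hξ => ?_
    rw [uIoc_of_le hx] at hξ
    rw [Real.rpow_neg (sub_nonneg.2 hξ.2), Real.sqrt_eq_rpow]
  simpa [IntervalIntegrable, IntegrableOn] using
    And.intro (h'.1.ofReal (𝕜 := ℂ)) (h'.2.ofReal (𝕜 := ℂ))

lemma integral_inv_sqrt_sub_mul_sqrt_pow (n : ℕ) {x : ℝ} (hx : 0 ≤ x) :
    ∫ ξ in (0:ℝ)..x, ((Real.sqrt (x - ξ) : ℝ) : ℂ)⁻¹ * ((Real.sqrt ξ : ℝ) : ℂ) ^ (2 * n + 1) =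
      ((Real.Gamma (1 / 2) * Real.Gamma ((n : ℝ) + 3 / 2) / Real.Gamma ((n : ℝ) + 2) : ℝ) : ℂ) *
        (x : ℂ) ^ (n + 1) := by
  rcases hx.eq_or_lt with rfl | hx
  · simp
  have hs : 0 < re (((n : ℝ) + 3 / 2 : ℝ) : ℂ) := by rw [ofReal_re]; positivity
  have ht : 0 < re (((1 / 2 : ℝ)) : ℂ) := by rw [ofReal_re]; norm_num
  have key := Complex.betaIntegral_scaled (((n : ℝ) + 3 / 2 : ℝ) : ℂ) ((1 / 2 : ℝ) : ℂ) hx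
  have hst : (((n : ℝ) + 3 / 2 : ℝ) : ℂ) + ((1 / 2 : ℝ) : ℂ) = (((n : ℝ) + 2 : ℝ) : ℂ) := by
    push_cast; ring
  have hG := Complex.Gamma_mul_Gamma_eq_betaIntegral hs ht
  rw [hst] at key hG
  simp only [Complex.Gamma_ofReal] at hG
  have hG2 : ((Real.Gamma ((n : ℝ) + 2) : ℝ) : ℂ) ≠ 0 := by
    exact_mod_cast (Real.Gamma_pos_of_pos (by positivity)).ne'
  have hB : Complex.betaIntegral (((n : ℝ) + 3 / 2 : ℝ) : ℂ) ((1 / 2 : ℝ) : ℂ) =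
      ((Real.Gamma (1 / 2) * Real.Gamma ((n : ℝ) + 3 / 2) / Real.Gamma ((n : ℝ) + 2) : ℝ) : ℂ) := by
    refine (eq_div_iff hG2).2 ?_ |>.trans (ofReal_div _ _).symm
    rw [ofReal_mul]
    linear_combination -hG
  have hpow : (x : ℂ) ^ ((((n : ℝ) + 2 : ℝ) : ℂ) - 1) = (x : ℂ) ^ (n + 1) := by
    rw [← Complex.cpow_natCast]
    congr 1
    push_cast; ring
  rw [hB, hpow, mul_comm] at key
  rw [← key]
  refine intervalIntegral.integral_congr_ae (ae_of_all _ fun ξ hξ => ?_)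
  rw [uIoc_of_le hx.le] at hξ
  have h1 : (ξ : ℂ) ^ ((((n : ℝ) + 3 / 2 : ℝ) : ℂ) - 1) =
      ((Real.sqrt ξ : ℝ) : ℂ) ^ (2 * n + 1) := by
    rw [← ofReal_one, ← ofReal_sub, ← ofReal_cpow hξ.1.le, ← ofReal_pow, Real.sqrt_eq_rpow,
      ← Real.rpow_mul_natCast hξ.1.le]
    congr 2
    push_cast; ring
  have h2 : ((x : ℂ) - ξ) ^ (((1 / 2 : ℝ) : ℂ) - 1) = ((Real.sqrt (x - ξ) : ℝ) : ℂ)⁻¹ := by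
    rw [← ofReal_one, ← ofReal_sub, ← ofReal_sub, ← ofReal_cpow (sub_nonneg.2 hξ.2), ← ofReal_inv,
      Real.sqrt_eq_rpow, ← Real.rpow_neg (sub_nonneg.2 hξ.2)]
    norm_num
  rw [h1, h2, mul_comm]

/-- For `f` odd analytic on `B(0,ρ)` with `f(y) = Σ_n a_n y^{2n+1}` and real
`0 ≤ x < ρ²`, the integral `∫_0^x (x-ξ)^{-1/2} f(√ξ) dξ` converges and equals
`Σ_n a_n (Γ(1/2)Γ(n+3/2)/Γ(n+2)) x^{n+1}`, the series converging absolutely. -/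
theorem stmt10 (ρ : ℝ) (hρ : 0 < ρ) (f : ℂ → ℂ) (a : ℕ → ℂ)
    (hf : ∀ y : ℂ, ‖y‖ < ρ → HasSum (fun n : ℕ => a n * y ^ (2 * n + 1)) (f y))
    (x : ℝ) (hx0 : 0 ≤ x) (hx : x < ρ ^ 2) :
    IntervalIntegrable
      (fun ξ : ℝ => ((Real.sqrt (x - ξ) : ℝ) : ℂ)⁻¹ * f ((Real.sqrt ξ : ℝ) : ℂ))
      volume 0 x ∧
    (Summable fun n : ℕ =>
      ‖a n * ((Real.Gamma (1 / 2) * Real.Gamma ((n : ℝ) + 3 / 2) / Real.Gamma ((n : ℝ) + 2) : ℝ) : ℂ) *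
        (x : ℂ) ^ (n + 1)‖) ∧
    HasSum (fun n : ℕ =>
        a n * ((Real.Gamma (1 / 2) * Real.Gamma ((n : ℝ) + 3 / 2) / Real.Gamma ((n : ℝ) + 2) : ℝ) : ℂ) *
          (x : ℂ) ^ (n + 1))
      (∫ ξ in (0:ℝ)..x, ((Real.sqrt (x - ξ) : ℝ) : ℂ)⁻¹ * f ((Real.sqrt ξ : ℝ) : ℂ)) := by
  have hsqrt : Real.sqrt x < ρ := (Real.sqrt_lt' hρ).2 hx
  have hsum : Summable fun n : ℕ => ‖a n‖ * Real.sqrt x ^ (2 * n + 1) := by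
    have := (hf (Real.sqrt x : ℝ) (by
      rwa [norm_real, Real.norm_of_nonneg (Real.sqrt_nonneg x)])).summable.norm
    simpa [abs_of_nonneg (Real.sqrt_nonneg x)] using this
  have hnorm : ∀ (n : ℕ), ∀ ξ ∈ Icc 0 x, ‖a n * ((Real.sqrt ξ : ℝ) : ℂ) ^ (2 * n + 1)‖ ≤
      ‖a n‖ * Real.sqrt x ^ (2 * n + 1) := by
    intro n ξ hξ
    rw [norm_mul, norm_pow, norm_real, Real.norm_of_nonneg (Real.sqrt_nonneg ξ)]
    gcongr
    exact hξ.2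
  have hfs : ∀ ξ ∈ Icc 0 x, HasSum
      (fun n : ℕ => a n * ((Real.sqrt ξ : ℝ) : ℂ) ^ (2 * n + 1)) (f ((Real.sqrt ξ : ℝ) : ℂ)) := by
    intro ξ hξ
    refine hf _ ?_
    rw [norm_real, Real.norm_of_nonneg (Real.sqrt_nonneg ξ)]
    exact (Real.sqrt_le_sqrt hξ.2).trans_lt hsqrt
  have hcont : ContinuousOn (fun ξ : ℝ => f ((Real.sqrt ξ : ℝ) : ℂ)) (uIcc 0 x) := by
    rw [uIcc_of_le hx0]
    refine (continuousOn_tsum (fun n => ?_) hsum hnorm).congr fun ξ hξ => (hfs ξ hξ).tsum_eq.symm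
    fun_prop
  have hw := intervalIntegrable_inv_sqrt_sub hx0
  have hsub : ∀ ξ ∈ uIoc 0 x, ξ ∈ Icc 0 x := fun ξ hξ => by
    rw [uIoc_of_le hx0] at hξ
    exact Ioc_subset_Icc_self hξ
  have main : HasSum (fun n : ℕ =>
      a n * ((Real.Gamma (1 / 2) * Real.Gamma ((n : ℝ) + 3 / 2) / Real.Gamma ((n : ℝ) + 2) : ℝ) : ℂ) *
        (x : ℂ) ^ (n + 1))
      (∫ ξ in (0:ℝ)..x, ((Real.sqrt (x - ξ) : ℝ) : ℂ)⁻¹ * f ((Real.sqrt ξ : ℝ) : ℂ)) := by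
    have h := intervalIntegral.hasSum_integral_of_dominated_convergence
      (μ := volume) (a := 0) (b := x)
      (F := fun (n : ℕ) (ξ : ℝ) => ((Real.sqrt (x - ξ) : ℝ) : ℂ)⁻¹ *
        (a n * ((Real.sqrt ξ : ℝ) : ℂ) ^ (2 * n + 1)))
      (f := fun ξ : ℝ => ((Real.sqrt (x - ξ) : ℝ) : ℂ)⁻¹ * f ((Real.sqrt ξ : ℝ) : ℂ))
      (fun n ξ => ‖((Real.sqrt (x - ξ) : ℝ) : ℂ)⁻¹‖ * (‖a n‖ * Real.sqrt x ^ (2 * n + 1)))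
      (fun n => (by fun_prop : Measurable _).aestronglyMeasurable)
      (fun n => ae_of_all _ fun ξ hξ => by
        rw [norm_mul]
        exact mul_le_mul_of_nonneg_left (hnorm n ξ (hsub ξ hξ)) (norm_nonneg _))
      (ae_of_all _ fun ξ _ => hsum.mul_left _)
      (by simpa only [tsum_mul_left] using hw.norm.mul_const _)
      (ae_of_all _ fun ξ hξ => (hfs ξ (hsub ξ hξ)).mul_left _)
    refine h.congr_fun fun n => ?_
    rw [mul_assoc, ← integral_inv_sqrt_sub_mul_sqrt_pow n hx0,
      ← intervalIntegral.integral_const_mul]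
    simp only [mul_left_comm]
  exact ⟨hw.mul_continuousOn hcont, main.summable.norm, main⟩
end

section
/- Let U ⊆ ℂ be an open set with 0 ∈ U and let f, g be analytic on U. Let S = { x ∈ ℂ : t·x ∈ U for all t ∈ [0,1] }, the set of points joined to 0 by a straight segment contained in U. Then S is open, and the convolution (f * g)(x) = x · ∫_0^1 f((1−t)x) g(tx) dt is a well-defined analytic function of x on S. -/
open Complex Filter MeasureTheory Metric Set Topology
open scoped Real Nat Classical

/-- The set of points all of whose multiples `t * x` with `t ∈ [0,1]` lie in an open set is open. -/
theorem isOpen_setOf_segment_subset {U : Set ℂ} (hU : IsOpen U) :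
    IsOpen {x : ℂ | ∀ t : ℝ, t ∈ Set.Icc (0 : ℝ) 1 → (t : ℂ) * x ∈ U} := by
  rw [isOpen_iff_mem_nhds]
  intro x hx
  refine isCompact_Icc.eventually_forall_of_forall_eventually fun t ht => ?_
  have hc : Continuous fun p : ℂ × ℝ => (p.2 : ℂ) * p.1 := by fun_prop
  exact hc.continuousAt.eventually (hU.mem_nhds (hx t ht))

/-- A parametric integral over a compact interval is holomorphic if the integrand and its
derivative in the parameter are jointly continuous. -/
theorem differentiableOn_intervalIntegral_of_continuousOn {E : Type*} [NormedAddCommGroup E]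
    [NormedSpace ℂ E] {S : Set ℂ} (hS : IsOpen S) {a b : ℝ} (hab : a ≤ b) {F F' : ℂ → ℝ → E}
    (hF : ContinuousOn (fun p : ℂ × ℝ => F p.1 p.2) (S ×ˢ Set.Icc a b))
    (hF' : ContinuousOn (fun p : ℂ × ℝ => F' p.1 p.2) (S ×ˢ Set.Icc a b))
    (hd : ∀ x ∈ S, ∀ t ∈ Set.Icc a b, HasDerivAt (fun y => F y t) (F' x t) x) :
    DifferentiableOn ℂ (fun x => ∫ t in a..b, F x t) S := by
  intro x₀ hx₀
  obtain ⟨r, hr, hrS⟩ := nhds_basis_closedBall.mem_iff.1 (hS.mem_nhds hx₀)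
  obtain ⟨C, hC⟩ := ((isCompact_closedBall x₀ r).prod isCompact_Icc).exists_bound_of_continuousOn
    (hF'.mono (prod_mono hrS Subset.rfl))
  have slice {G : ℂ → ℝ → E} (hG : ContinuousOn (fun p : ℂ × ℝ => G p.1 p.2) (S ×ˢ Set.Icc a b))
      {x : ℂ} (hx : x ∈ S) : IntervalIntegrable (G x) volume a b :=
    ContinuousOn.intervalIntegrable_of_Icc hab
      (hG.comp (f := fun t : ℝ => (x, t)) (by fun_prop) fun t ht => ⟨hx, ht⟩)
  have hsub : ∀ t ∈ Set.uIoc a b, t ∈ Set.Icc a b := fun t ht =>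
    Set.Ioc_subset_Icc_self (Set.uIoc_of_le hab ▸ ht)
  refine (intervalIntegral.hasDerivAt_integral_of_dominated_loc_of_deriv_le (μ := volume)
    (F' := F') (bound := fun _ => C) (closedBall_mem_nhds x₀ hr) ?_ (slice hF hx₀)
    (slice hF' hx₀).def'.aestronglyMeasurable ?_ intervalIntegrable_const
    ?_).2.differentiableAt.differentiableWithinAt
  · filter_upwards [hS.mem_nhds hx₀] with x hx
    exact (slice hF hx).def'.aestronglyMeasurable
  · exact .of_forall fun t ht x hx => hC (x, t) ⟨hx, hsub t ht⟩
  · exact .of_forall fun t ht x hx => hd x (hrS hx) t (hsub t ht)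

/-- For `f, g` analytic on an open set `U ∋ 0`, the set `S` of points joined to `0`
by a straight segment contained in `U` is open, and the convolution
`(f*g)(x) = x ∫_0^1 f((1-t)x) g(tx) dt` is a well-defined analytic function on `S`. -/
theorem stmt11 (U : Set ℂ) (hU : IsOpen U) (h0 : (0 : ℂ) ∈ U)
    (f g : ℂ → ℂ) (hf : AnalyticOnNhd ℂ f U) (hg : AnalyticOnNhd ℂ g U) :
    IsOpen {x : ℂ | ∀ t : ℝ, t ∈ Set.Icc (0 : ℝ) 1 → (t : ℂ) * x ∈ U} ∧
    (∀ x ∈ {x : ℂ | ∀ t : ℝ, t ∈ Set.Icc (0 : ℝ) 1 → (t : ℂ) * x ∈ U},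
      IntervalIntegrable (fun t : ℝ => f ((1 - (t : ℂ)) * x) * g ((t : ℂ) * x)) volume 0 1) ∧
    AnalyticOnNhd ℂ (fun x : ℂ => x * ∫ t in (0:ℝ)..1, f ((1 - (t : ℂ)) * x) * g ((t : ℂ) * x))
      {x : ℂ | ∀ t : ℝ, t ∈ Set.Icc (0 : ℝ) 1 → (t : ℂ) * x ∈ U} := by
  set S := {x : ℂ | ∀ t : ℝ, t ∈ Set.Icc (0 : ℝ) 1 → (t : ℂ) * x ∈ U}
  have hS : IsOpen S := isOpen_setOf_segment_subset hU
  have memg : ∀ x ∈ S, ∀ t ∈ Set.Icc (0 : ℝ) 1, (t : ℂ) * x ∈ U := fun x hx t ht => hx t ht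
  have memf : ∀ x ∈ S, ∀ t ∈ Set.Icc (0 : ℝ) 1, (1 - (t : ℂ)) * x ∈ U := fun x hx t ht => by
    simpa using hx (1 - t) ⟨by linarith [ht.2], by linarith [ht.1]⟩
  have contf {h : ℂ → ℂ} (hh : AnalyticOnNhd ℂ h U) : ContinuousOn
      (fun p : ℂ × ℝ => h ((1 - (p.2 : ℂ)) * p.1)) (S ×ˢ Set.Icc (0 : ℝ) 1) :=
    hh.continuousOn.comp (f := fun p : ℂ × ℝ => (1 - (p.2 : ℂ)) * p.1) (by fun_prop)
      fun p hp => memf p.1 hp.1 p.2 hp.2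
  have contg {h : ℂ → ℂ} (hh : AnalyticOnNhd ℂ h U) : ContinuousOn
      (fun p : ℂ × ℝ => h ((p.2 : ℂ) * p.1)) (S ×ˢ Set.Icc (0 : ℝ) 1) :=
    hh.continuousOn.comp (f := fun p : ℂ × ℝ => (p.2 : ℂ) * p.1) (by fun_prop)
      fun p hp => memg p.1 hp.1 p.2 hp.2
  have hF := (contf hf).mul (contg hg)
  refine ⟨hS, fun x hx => ?_, ?_⟩
  · exact ContinuousOn.intervalIntegrable_of_Icc zero_le_one
      (hF.comp (f := fun t : ℝ => (x, t)) (by fun_prop) fun t ht => ⟨hx, ht⟩)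
  · refine (differentiableOn_id.mul (differentiableOn_intervalIntegral_of_continuousOn hS
      zero_le_one (F := fun x t => f ((1 - (t : ℂ)) * x) * g ((t : ℂ) * x))
      (F' := fun x t => deriv f ((1 - (t : ℂ)) * x) * (1 - (t : ℂ)) * g ((t : ℂ) * x) +
        f ((1 - (t : ℂ)) * x) * (deriv g ((t : ℂ) * x) * (t : ℂ)))
      hF ?_ fun x hx t ht => ?_)).analyticOnNhd hS
    · exact (((contf hf.deriv).mul (by fun_prop)).mul (contg hg)).add
        ((contf hf).mul ((contg hg.deriv).mul (by fun_prop)))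
    · have hlin (c : ℂ) : HasDerivAt (fun y : ℂ => c * y) c x := by
        simpa using (hasDerivAt_id x).const_mul c
      exact ((hf _ (memf x hx t ht)).differentiableAt.hasDerivAt.comp x (hlin _)).mul
        ((hg _ (memg x hx t ht)).differentiableAt.hasDerivAt.comp x (hlin _))
end
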